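/- arXiv:2008.11645 — 4 statements merged into one kernel-verified Lean document; each statement's English description precedes it below -/
import Mathlib

section
/- Let $q<0$ and $p>0$. Define $Q_0:\mathbb{R}\to\mathbb{R}$ by $Q_0(x)=\Big(\tfrac{(p+2)q^2}{(p|q|\,|x|+2)^2}\Big)^{1/p}$. Then $Q_0$ is positive and continuous on $\mathbb{R}$, smooth on $\mathbb{R}\setminus\{0\}$, satisfies $-\tfrac12 Q_0''(x)+Q_0(x)^{p+1}=0$ for every $x\neq 0$, and satisfies the delta-potential jump condition at $0$. (Thus $Q_0$ is the zero-frequency stationary solution of the defocusing NLS with attractive delta potential, $HQ_0+Q_0^{p+1}=0$.) -/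
open Real Set

/-- The delta-potential jump condition at `0` for a real-valued function:
the one-sided derivatives at `0` exist and satisfy `u'(0⁺) - u'(0⁻) = 2 q u(0)`. -/
def DeltaJumpCond (q : ℝ) (u : ℝ → ℝ) : Prop :=
  ∃ dp dm : ℝ, HasDerivWithinAt u dp (Set.Ici 0) 0 ∧ HasDerivWithinAt u dm (Set.Iic 0) 0 ∧
    dp - dm = 2 * q * u 0

/-- The zero-frequency stationary profile of the defocusing NLS with delta potential. -/
noncomputable def Qzero (q p : ℝ) : ℝ → ℝ := fun x =>
  ((p + 2) * q ^ 2 / (p * |q| * |x| + 2) ^ 2) ^ (1 / p)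

lemma Qzero_eq (q p x : ℝ) (hp : 0 < p) :
    Qzero q p x = ((p + 2) * q ^ 2) ^ (1 / p) * (p * |q| * |x| + 2) ^ (-2 / p) := by
  have hs : 0 < p * |q| * |x| + 2 := by positivity
  unfold Qzero
  rw [div_rpow (by positivity) (by positivity), div_eq_mul_inv, ← rpow_natCast (p * |q| * |x| + 2) 2,
    ← rpow_mul hs.le, ← rpow_neg hs.le]
  congr 2
  push_cast
  ring

lemma Qzero_pos {q p : ℝ} (hq : q ≠ 0) (hp : 0 < p) (x : ℝ) : 0 < Qzero q p x := by
  have : 0 < q ^ 2 := by positivity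
  unfold Qzero
  positivity

lemma continuous_Qzero (q : ℝ) {p : ℝ} (hp : 0 < p) : Continuous (Qzero q p) := by
  have hs (x : ℝ) : 0 < p * |q| * |x| + 2 := by positivity
  rw [show Qzero q p = _ from funext fun x => Qzero_eq q p x hp]
  exact continuous_const.mul
    ((by fun_prop : Continuous fun x : ℝ => p * |q| * |x| + 2).rpow_const
      fun x => Or.inl (hs x).ne')

lemma contDiffOn_Qzero (q : ℝ) {p : ℝ} (hp : 0 < p) :
    ContDiffOn ℝ (⊤ : ℕ∞) (Qzero q p) {0}ᶜ := by
  intro x hx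
  have hs : p * |q| * |x| + 2 ≠ 0 := by positivity
  rw [show Qzero q p = _ from funext fun x => Qzero_eq q p x hp]
  have h : ContDiffAt ℝ (⊤ : ℕ∞) (fun y : ℝ => p * |q| * |y| + 2) x :=
    (contDiffAt_const.mul (contDiffAt_abs hx)).add contDiffAt_const
  exact (contDiffAt_const.mul (h.rpow_const_of_ne hs)).contDiffWithinAt

lemma hasDerivAt_const_mul_affine_rpow (C b r : ℝ) {x : ℝ} (h : 0 < b * x + 2) :
    HasDerivAt (fun y => C * (b * y + 2) ^ r) (C * b * r * (b * x + 2) ^ (r - 1)) x := by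
  have h1 : HasDerivAt (fun y : ℝ => b * y + 2) b x := by
    simpa using ((hasDerivAt_id x).const_mul b).add_const 2
  exact ((h1.rpow_const (p := r) (Or.inl h.ne')).const_mul C).congr_deriv (by ring)

lemma exists_sq_eq_one_eventually_abs_eq {x : ℝ} (hx : x ≠ 0) :
    ∃ σ : ℝ, σ ^ 2 = 1 ∧ ∀ᶠ y in nhds x, |y| = σ * y := by
  rcases hx.lt_or_gt with h | h
  · refine ⟨-1, by norm_num, ?_⟩
    filter_upwards [eventually_lt_nhds h] with y hy
    simp [abs_of_neg hy]
  · refine ⟨1, by norm_num, ?_⟩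
    filter_upwards [eventually_gt_nhds h] with y hy
    simp [abs_of_pos hy]

lemma deriv_deriv_Qzero (q : ℝ) {p x : ℝ} (hp : 0 < p) (hx : x ≠ 0) :
    deriv (deriv (Qzero q p)) x = 2 * ((p + 2) * q ^ 2) *
      (((p + 2) * q ^ 2) ^ (1 / p) * (p * |q| * |x| + 2) ^ (-2 / p - 2)) := by
  set C := ((p + 2) * q ^ 2) ^ (1 / p)
  obtain ⟨σ, hσ2, habs⟩ := exists_sq_eq_one_eventually_abs_eq hx
  have hpos : ∀ {y : ℝ}, |y| = σ * y → 0 < p * |q| * σ * y + 2 := by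
    intro y hy
    rw [mul_assoc _ σ, ← hy]
    positivity
  have hQ : Qzero q p =ᶠ[nhds x] fun y => C * (p * |q| * σ * y + 2) ^ (-2 / p) := by
    filter_upwards [habs] with y hy
    rw [Qzero_eq q p y hp, hy, mul_assoc _ σ]
  have hQ' : deriv (Qzero q p) =ᶠ[nhds x] fun y =>
      C * (p * |q| * σ) * (-2 / p) * (p * |q| * σ * y + 2) ^ (-2 / p - 1) := by
    filter_upwards [hQ.deriv, habs] with y hy hya
    rw [hy, (hasDerivAt_const_mul_affine_rpow C _ _ (hpos hya)).deriv]
  rw [hQ'.deriv_eq,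
    (hasDerivAt_const_mul_affine_rpow _ _ _ (hpos habs.self_of_nhds)).deriv,
    mul_assoc _ σ x, ← habs.self_of_nhds, show -2 / p - 1 - 1 = -2 / p - 2 by ring,
    ← sq_abs q]
  field_simp
  rw [hσ2]
  ring

lemma Qzero_rpow_add_one {q p : ℝ} (hq : q ≠ 0) (hp : 0 < p) (x : ℝ) :
    Qzero q p x ^ (p + 1) = ((p + 2) * q ^ 2) *
      (((p + 2) * q ^ 2) ^ (1 / p) * (p * |q| * |x| + 2) ^ (-2 / p - 2)) := by
  have hs : 0 < p * |q| * |x| + 2 := by positivity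
  have hA : 0 < (p + 2) * q ^ 2 := by positivity
  rw [Qzero_eq q p x hp, mul_rpow (by positivity) (by positivity), ← rpow_mul hA.le,
    ← rpow_mul hs.le, show 1 / p * (p + 1) = 1 + 1 / p by field_simp,
    show -2 / p * (p + 1) = -2 / p - 2 by field_simp; ring, rpow_add hA, rpow_one, mul_assoc]

lemma deltaJumpCond_Qzero {q p : ℝ} (hq : q < 0) (hp : 0 < p) :
    DeltaJumpCond q (Qzero q p) := by
  have hQ0 : Qzero q p 0 = ((p + 2) * q ^ 2) ^ (1 / p) * 2 ^ (-2 / p) := by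
    simp [Qzero_eq q p 0 hp]
  have key (b : ℝ) : HasDerivAt
      (fun y => ((p + 2) * q ^ 2) ^ (1 / p) * (p * b * y + 2) ^ (-2 / p))
      (-b * Qzero q p 0) 0 := by
    refine (hasDerivAt_const_mul_affine_rpow _ _ _ (by norm_num)).congr_deriv ?_
    rw [hQ0, mul_zero, zero_add, rpow_sub_one two_ne_zero]
    field_simp
  refine ⟨q * Qzero q p 0, -q * Qzero q p 0, ?_, ?_, by ring⟩
  · refine ((key (-q)).congr_deriv (by ring)).hasDerivWithinAt.congr_of_mem (fun y hy => ?_)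
      self_mem_Ici
    rw [Qzero_eq q p y hp, abs_of_neg hq, abs_of_nonneg hy]
  · refine (key q).hasDerivWithinAt.congr_of_mem (fun y hy => ?_) self_mem_Iic
    rw [Qzero_eq q p y hp, abs_of_neg hq, abs_of_nonpos hy]
    ring_nf

theorem statement2 (q p : ℝ) (hq : q < 0) (hp : 0 < p) :
    (∀ x : ℝ, 0 < Qzero q p x) ∧
    Continuous (Qzero q p) ∧
    ContDiffOn ℝ (⊤ : ℕ∞) (Qzero q p) {0}ᶜ ∧
    (∀ x : ℝ, x ≠ 0 →
      -(1 / 2) * deriv (deriv (Qzero q p)) x + (Qzero q p x) ^ (p + 1) = 0) ∧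
    DeltaJumpCond q (Qzero q p) := by
  refine ⟨Qzero_pos hq.ne hp, continuous_Qzero q hp, contDiffOn_Qzero q hp, fun x hx => ?_,
    deltaJumpCond_Qzero hq hp⟩
  rw [deriv_deriv_Qzero q hp hx, Qzero_rpow_add_one hq.ne hp]
  ring
end

section
/- Let $\gamma>0$, $x_0\in\mathbb{R}$, and $m,n\in\mathbb{N}\cup\{0\}$. Then there exists a constant $C=C(m,n,\gamma,x_0)>0$ such that for every $\mu>0$ and every $x\ge\max(0,x_0)$, $\int_{x_0}^{x}(x-y)^n e^{\mu(y-x)}\int_{y}^{\infty}(z-y)^{m} e^{-\mu(z-y)}e^{-\gamma z}\,dz\,dy\;\le\;C\,\mu^{-(m+n)-2}\,\langle x\rangle^{n+1}\,e^{-x\min(\mu,\gamma)}$. -/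
open Real Set MeasureTheory intervalIntegral

theorem integral_Ioi_pow_mul_exp_neg_mul (n : ℕ) {r : ℝ} (hr : 0 < r) :
    ∫ t in Ioi (0 : ℝ), t ^ n * Real.exp (-r * t) = n.factorial / r ^ (n + 1) := by
  have h := Real.integral_rpow_mul_exp_neg_mul_Ioi (a := (n : ℝ) + 1) (by positivity) hr
  rw [Real.Gamma_nat_eq_factorial] at h
  simp only [add_sub_cancel_right, Real.rpow_natCast, ← neg_mul] at h
  rw [h, ← Nat.cast_succ, Real.rpow_natCast, Nat.succ_eq_add_one, div_pow, one_pow]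
  ring

theorem integrableOn_Ioi_pow_mul_exp_neg_mul (n : ℕ) {r : ℝ} (hr : 0 < r) :
    IntegrableOn (fun t : ℝ => t ^ n * Real.exp (-r * t)) (Ioi 0) := by
  refine Integrable.of_integral_ne_zero ?_
  rw [integral_Ioi_pow_mul_exp_neg_mul n hr]
  positivity

theorem integral_Ioi_sub_pow_mul_exp_mul_exp (m : ℕ) {μ γ : ℝ} (hμ : 0 < μ) (hγ : 0 < γ) (y : ℝ) :
    ∫ z in Ioi y, (z - y) ^ m * Real.exp (-μ * (z - y)) * Real.exp (-γ * z) =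
      m.factorial / (μ + γ) ^ (m + 1) * Real.exp (-γ * y) := by
  have h := (measurePreserving_sub_right (volume : Measure ℝ) y).setIntegral_preimage_emb
    (measurableEmbedding_subRight y)
    (fun t : ℝ => t ^ m * Real.exp (-(μ + γ) * t)) (Ioi 0)
  rw [integral_Ioi_pow_mul_exp_neg_mul m (by positivity)] at h
  simp only [preimage_sub_const_Ioi, zero_add] at h
  rw [← h, ← MeasureTheory.integral_mul_const]
  congr 1 with z
  rw [mul_assoc, mul_assoc, ← Real.exp_add, ← Real.exp_add]
  ring_nf

theorem integral_pow_mul_exp_le (n : ℕ) {r L : ℝ} (hr : 0 < r) (hL : 0 ≤ L) :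
    ∫ t in (0 : ℝ)..L, t ^ n * Real.exp (-r * t) ≤ n.factorial / r ^ (n + 1) := by
  rw [integral_of_le hL, ← integral_Ioi_pow_mul_exp_neg_mul n hr]
  refine setIntegral_mono_set (integrableOn_Ioi_pow_mul_exp_neg_mul n hr) ?_
    Ioc_subset_Ioi_self.eventuallyLE
  filter_upwards [ae_restrict_mem measurableSet_Ioi] with t ht
  have : 0 < t := ht
  simp only [Pi.zero_apply]
  positivity

theorem integral_iterated_eq (m n : ℕ) {μ γ : ℝ} (hμ : 0 < μ) (hγ : 0 < γ) (x0 x : ℝ) :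
    (∫ y in x0..x, (x - y) ^ n * Real.exp (μ * (y - x)) *
        ∫ z in Ioi y, (z - y) ^ m * Real.exp (-μ * (z - y)) * Real.exp (-γ * z)) =
      m.factorial / (μ + γ) ^ (m + 1) *
        (Real.exp (-γ * x) * ∫ t in (0 : ℝ)..(x - x0), t ^ n * Real.exp ((γ - μ) * t)) := by
  have h := intervalIntegral.integral_comp_sub_left
    (fun t : ℝ => t ^ n * Real.exp ((γ - μ) * t)) x (a := x0) (b := x)
  rw [sub_self] at h
  rw [← h, ← intervalIntegral.integral_const_mul, ← intervalIntegral.integral_const_mul]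
  congr 1 with y
  rw [integral_Ioi_sub_pow_mul_exp_mul_exp m hμ hγ]
  have : Real.exp (μ * (y - x)) * Real.exp (-γ * y) =
      Real.exp (-γ * x) * Real.exp ((γ - μ) * (x - y)) := by
    rw [← Real.exp_add, ← Real.exp_add]
    ring_nf
  linear_combination (x - y) ^ n * (m.factorial / (μ + γ) ^ (m + 1)) * this

theorem exp_mul_integral_le_of_le (n : ℕ) {μ γ x0 x : ℝ} (hμ : 0 < μ) (hγ : 0 < γ)
    (hx0 : x0 ≤ x) :
    Real.exp (-γ * x) * ∫ t in (0 : ℝ)..(x - x0), t ^ n * Real.exp ((γ - μ) * t) ≤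
      Real.exp (γ * |x0|) * (x - x0) ^ (n + 1) * Real.exp (-x * min μ γ) := by
  have hL : 0 ≤ x - x0 := sub_nonneg.2 hx0
  rw [← intervalIntegral.integral_const_mul]
  have hb : ∀ t ∈ Icc 0 (x - x0), Real.exp (-γ * x) * (t ^ n * Real.exp ((γ - μ) * t)) ≤
      (x - x0) ^ n * Real.exp (γ * |x0| + -x * min μ γ) := by
    intro t ht
    have h1 : t ^ n ≤ (x - x0) ^ n := pow_le_pow_left₀ ht.1 ht.2 n
    have h2 : Real.exp (-γ * x + (γ - μ) * t) ≤ Real.exp (γ * |x0| + -x * min μ γ) := by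
      apply Real.exp_le_exp.2
      have ha := neg_abs_le x0
      have hb := abs_nonneg x0
      have ht1 := ht.1
      have ht2 := ht.2
      rcases le_total μ γ with h | h
      · rw [min_eq_left h]
        have : (γ - μ) * t ≤ (γ - μ) * (x + |x0|) :=
          mul_le_mul_of_nonneg_left (by linarith) (by linarith)
        nlinarith
      · rw [min_eq_right h]
        nlinarith
    rw [Real.exp_add] at h2
    calc _ = t ^ n * (Real.exp (-γ * x) * Real.exp ((γ - μ) * t)) := by ring
      _ ≤ _ := mul_le_mul h1 h2 (by positivity) (by positivity)
  refine (intervalIntegral.integral_mono_on hL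
    (Continuous.intervalIntegrable (by fun_prop) _ _) intervalIntegrable_const hb).trans_eq ?_
  rw [intervalIntegral.integral_const, Real.exp_add, smul_eq_mul]
  ring

theorem exp_mul_integral_le_of_two_mul_le (n : ℕ) {μ γ x0 x : ℝ} (hγ : 0 < γ)
    (hμ : 2 * γ ≤ μ) (hx0 : x0 ≤ x) :
    Real.exp (-γ * x) * ∫ t in (0 : ℝ)..(x - x0), t ^ n * Real.exp ((γ - μ) * t) ≤
      n.factorial * 2 ^ (n + 1) / μ ^ (n + 1) * Real.exp (-x * min μ γ) := by
  have h := integral_pow_mul_exp_le n (r := μ - γ) (by linarith) (sub_nonneg.2 hx0)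
  rw [neg_sub] at h
  have hμ0 : 0 < μ := by linarith
  have h2 : (n.factorial : ℝ) / (μ - γ) ^ (n + 1) ≤ n.factorial * 2 ^ (n + 1) / μ ^ (n + 1) := by
    calc _ ≤ (n.factorial : ℝ) / (μ / 2) ^ (n + 1) := by gcongr; linarith
      _ = _ := by rw [div_pow]; field_simp
  rw [min_eq_right (by linarith), mul_comm, show -x * γ = -γ * x by ring]
  exact mul_le_mul_of_nonneg_right (h.trans h2) (by positivity)

theorem statement11 (γ : ℝ) (hγ : 0 < γ) (x0 : ℝ) (m n : ℕ) :
    ∃ C : ℝ, 0 < C ∧ ∀ μ : ℝ, 0 < μ → ∀ x : ℝ, max 0 x0 ≤ x →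
      (∫ y in x0..x, (x - y) ^ n * Real.exp (μ * (y - x)) *
          ∫ z in Set.Ioi y, (z - y) ^ m * Real.exp (-μ * (z - y)) * Real.exp (-γ * z))
        ≤ C * μ ^ (-((m : ℝ) + n) - 2) * Real.sqrt (1 + x ^ 2) ^ (n + 1) *
            Real.exp (-x * min μ γ) := by
  let A : ℝ := (n.factorial : ℝ) * 2 ^ (n + 1) +
    Real.exp (γ * |x0|) * (1 + |x0|) ^ (n + 1) * (2 * γ) ^ (n + 1)
  refine ⟨m.factorial * A, by positivity, fun μ hμ x hx => ?_⟩
  have hx0 : x0 ≤ x := (le_max_right _ _).trans hx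
  have hpow : μ ^ (-((m : ℝ) + n) - 2) = 1 / μ ^ (m + 1) * (1 / μ ^ (n + 1)) := by
    rw [show -((m : ℝ) + n) - 2 = -((m + 1 + (n + 1) : ℕ) : ℝ) by push_cast; ring,
      Real.rpow_neg hμ.le, Real.rpow_natCast, pow_add]
    field_simp
  set S := Real.sqrt (1 + x ^ 2)
  have hS1 : 1 ≤ S := Real.one_le_sqrt.2 (by nlinarith [sq_nonneg x])
  have hSx : x ≤ S := Real.le_sqrt_of_sq_le (by linarith)
  have hJ : Real.exp (-γ * x) * ∫ t in (0 : ℝ)..(x - x0), t ^ n * Real.exp ((γ - μ) * t) ≤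
      A * (1 / μ ^ (n + 1)) * S ^ (n + 1) * Real.exp (-x * min μ γ) := by
    rcases le_total (2 * γ) μ with h | h
    · refine (exp_mul_integral_le_of_two_mul_le n hγ h hx0).trans ?_
      refine mul_le_mul_of_nonneg_right ?_ (by positivity)
      calc (n.factorial : ℝ) * 2 ^ (n + 1) / μ ^ (n + 1)
          = (n.factorial : ℝ) * 2 ^ (n + 1) * (1 / μ ^ (n + 1)) * 1 := by ring
        _ ≤ A * (1 / μ ^ (n + 1)) * S ^ (n + 1) := by
          gcongr
          · exact le_add_of_nonneg_right (by positivity)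
          · exact one_le_pow₀ hS1
    · refine (exp_mul_integral_le_of_le n hμ hγ hx0).trans ?_
      refine mul_le_mul_of_nonneg_right ?_ (by positivity)
      have hL : x - x0 ≤ (1 + |x0|) * S := by
        nlinarith [neg_abs_le x0, abs_nonneg x0]
      have hq : 1 ≤ (2 * γ) ^ (n + 1) * (1 / μ ^ (n + 1)) := by
        rw [mul_one_div, one_le_div (by positivity)]
        gcongr
      calc Real.exp (γ * |x0|) * (x - x0) ^ (n + 1)
          ≤ Real.exp (γ * |x0|) * ((1 + |x0|) * S) ^ (n + 1) * 1 := by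
            rw [mul_one]
            have := sub_nonneg.2 hx0
            gcongr
        _ ≤ Real.exp (γ * |x0|) * ((1 + |x0|) * S) ^ (n + 1) *
              ((2 * γ) ^ (n + 1) * (1 / μ ^ (n + 1))) := by gcongr
        _ = Real.exp (γ * |x0|) * (1 + |x0|) ^ (n + 1) * (2 * γ) ^ (n + 1) *
              (1 / μ ^ (n + 1)) * S ^ (n + 1) := by rw [mul_pow]; ring
        _ ≤ A * (1 / μ ^ (n + 1)) * S ^ (n + 1) := by
          gcongr
          exact le_add_of_nonneg_left (by positivity)
  rw [integral_iterated_eq m n hμ hγ, hpow]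
  calc _ ≤ m.factorial / (μ + γ) ^ (m + 1) *
        (A * (1 / μ ^ (n + 1)) * S ^ (n + 1) * Real.exp (-x * min μ γ)) := by gcongr
    _ ≤ m.factorial / μ ^ (m + 1) *
        (A * (1 / μ ^ (n + 1)) * S ^ (n + 1) * Real.exp (-x * min μ γ)) := by
      gcongr
      linarith
    _ = _ := by ring
end

section
/- Let $\xi\in\mathbb{R}$, $\omega>0$, $\mu=\sqrt{\xi^2+4\omega}$, $\gamma>0$, $C_0>0$, and let $V_1,V_2:(0,\infty)\to\mathbb{R}$ be smooth with $|V_1(x)|+|V_2(x)|\le C_0 e^{-\gamma x}$ for all $x>0$. Then there exists a solution $f_3=(f_3^{(1)},f_3^{(2)})$ of the generalized eigenvalue system on $(0,\infty)$ and a constant $C$ (depending only on $C_0$, $\gamma$, $\omega$) such that $\big|e^{\mu x}f_3(x)-(0,1)\big|\le C\,\mu^{-1}e^{-\gamma x}$ for all $x>0$; moreover, any two solutions of the system on $(0,\infty)$ satisfying an estimate of this form coincide. -/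
open Real Set

/-- The pair `(f₁, f₂)` solves the generalized eigenvalue system
`-½ f₁'' + (ω + V₁) f₁ + V₂ f₂ = (ξ²/2 + ω) f₁`,
`½ f₂'' - (ω + V₁) f₂ - V₂ f₁ = (ξ²/2 + ω) f₂` on the set `s`,
with the required twice differentiability. -/
def SolvesGEP (ξ ω : ℝ) (V1 V2 : ℝ → ℝ) (f1 f2 : ℝ → ℂ) (s : Set ℝ) : Prop :=
  (∀ x ∈ s, DifferentiableAt ℝ f1 x ∧ DifferentiableAt ℝ (deriv f1) x ∧
    DifferentiableAt ℝ f2 x ∧ DifferentiableAt ℝ (deriv f2) x) ∧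
  (∀ x ∈ s,
    -(1 / 2) * deriv (deriv f1) x + ((ω : ℂ) + (V1 x : ℂ)) * f1 x + (V2 x : ℂ) * f2 x
      = ((ξ ^ 2 / 2 + ω : ℝ) : ℂ) * f1 x ∧
    (1 / 2) * deriv (deriv f2) x - ((ω : ℂ) + (V1 x : ℂ)) * f2 x - (V2 x : ℂ) * f1 x
      = ((ξ ^ 2 / 2 + ω : ℝ) : ℂ) * f2 x)

open MeasureTheory Filter Topology
open scoped BoundedContinuousFunction

theorem integrableOn_const_mul_exp_neg {γ : ℝ} (hγ : 0 < γ) (B x : ℝ) :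
    IntegrableOn (fun y => B * exp (-γ * y)) (Ioi x) :=
  (integrableOn_exp_mul_Ioi (neg_lt_zero.2 hγ) x).const_mul B

theorem integral_const_mul_exp_neg {γ : ℝ} (hγ : 0 < γ) (B x : ℝ) :
    ∫ y in Ioi x, B * exp (-γ * y) = B / γ * exp (-γ * x) := by
  rw [integral_const_mul, integral_exp_mul_Ioi (neg_lt_zero.2 hγ)]
  field_simp

section Volterra

variable {E : Type*} [NormedAddCommGroup E] [NormedSpace ℝ E]

theorem setIntegral_Ioi_zero_eq_of_forall_le {F : ℝ → E} {x : ℝ} (hx : 0 ≤ x)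
    (h : ∀ y, 0 < y → y ≤ x → F y = 0) : ∫ y in Ioi 0, F y = ∫ y in Ioi x, F y :=
  setIntegral_eq_of_subset_of_forall_sdiff_eq_zero measurableSet_Ioi (Ioi_subset_Ioi hx)
    fun y hy => h y hy.1 (not_lt.1 hy.2)

/-- The weight `exp (l * exp (-γ y))` turns a Volterra operator whose kernel decays like
`exp (-γ y)` into a contraction. -/
theorem integral_exp_neg_mul_weight {γ l : ℝ} (hγ : 0 < γ) (hl : 0 < l) (M x : ℝ) (hM : 0 ≤ M) :
    IntegrableOn (fun y => M * exp (-γ * y) * exp (l * exp (-γ * y))) (Ioi x) ∧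
    ∫ y in Ioi x, M * exp (-γ * y) * exp (l * exp (-γ * y)) =
      M / (γ * l) * (exp (l * exp (-γ * x)) - 1) := by
  have hd : ∀ y ∈ Ici x, HasDerivAt (fun y => -(M / (γ * l)) * exp (l * exp (-γ * y)))
      (M * exp (-γ * y) * exp (l * exp (-γ * y))) y := by
    intro y _
    have h := ((((hasDerivAt_id y).const_mul (-γ)).exp.const_mul l).exp).const_mul (-(M / (γ * l)))
    refine h.congr_deriv ?_
    simp only [id]
    field_simp
  have hlim : Tendsto (fun y => -(M / (γ * l)) * exp (l * exp (-γ * y))) atTop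
      (𝓝 (-(M / (γ * l)) * exp (l * 0))) := by
    have h1 : Tendsto (fun y => exp (-γ * y)) atTop (𝓝 0) :=
      tendsto_exp_atBot.comp (tendsto_id.const_mul_atTop_of_neg (neg_lt_zero.2 hγ))
    exact ((continuous_exp.tendsto _).comp (h1.const_mul l)).const_mul _
  have hpos : ∀ y ∈ Ioi x, 0 ≤ M * exp (-γ * y) * exp (l * exp (-γ * y)) :=
    fun y _ => by positivity
  refine ⟨integrableOn_Ioi_deriv_of_nonneg' hd hpos hlim, ?_⟩
  rw [integral_Ioi_of_hasDerivAt_of_nonneg' hd hpos hlim]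
  simp
  ring

/-- Solvability of a Volterra integral equation posed from `+∞`, with an exponentially decaying
kernel. -/
theorem exists_volterra_solution [CompleteSpace E] {A : ℝ → ℝ → E →L[ℝ] E} {M γ l : ℝ}
    (hγ : 0 < γ) (hl : 0 < l) (hM : 0 ≤ M) (hMl : 2 * M ≤ γ * l)
    (hcont : ∀ y, 0 < y → Continuous fun x => A x y)
    (hmeas : ∀ x, AEStronglyMeasurable (A x) (volume.restrict (Ioi 0)))
    (hzero : ∀ x y, y ≤ x → A x y = 0)
    (hbd : ∀ x y, 0 < y → ‖A x y‖ ≤ M * exp (-γ * y)) (a : E) :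
    ∃ u : ℝ → E, Continuous u ∧ (∀ x, ‖u x‖ ≤ 2 * exp l * ‖a‖) ∧
      (∀ x, IntegrableOn (fun y => A x y (u y)) (Ioi 0)) ∧
      ∀ x, u x = a + ∫ y in Ioi 0, A x y (u y) := by
  set W : ℝ → ℝ := fun y => exp (l * exp (-γ * max y 0)) with hW
  have hWc : Continuous W := by fun_prop
  have hW1 : ∀ y, 1 ≤ W y := fun y => one_le_exp (by positivity)
  have hW0 : ∀ y, 0 < W y := fun y => exp_pos _
  have hWl : ∀ y, W y ≤ exp l := fun y => by
    refine exp_le_exp.2 (mul_le_of_le_one_right hl.le (exp_le_one_iff.2 ?_))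
    have := le_max_right y 0
    nlinarith
  have hJm : ∀ {f : ℝ → E}, Continuous f → ∀ x,
      AEStronglyMeasurable (fun y => A x y (f y)) (volume.restrict (Ioi 0)) := fun hf x =>
    (ContinuousLinearMap.apply ℝ E).flip.aestronglyMeasurable_comp₂ (hmeas x)
      hf.aestronglyMeasurable
  have hle : ∀ {f : ℝ → E} {B : ℝ}, (∀ y, ‖f y‖ ≤ B * W y) → ∀ x y, 0 < y →
      ‖A x y (f y)‖ ≤ M * B * exp (-γ * y) * exp (l * exp (-γ * y)) := by
    intro f B hB x y hy
    refine ((A x y).le_opNorm _).trans ?_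
    calc ‖A x y‖ * ‖f y‖ ≤ (M * exp (-γ * y)) * (B * W y) :=
          mul_le_mul (hbd x y hy) (hB y) (norm_nonneg _) (by positivity)
      _ = _ := by simp only [hW, max_eq_left hy.le]; ring
  have hBnn : ∀ {f : ℝ → E} {B : ℝ}, (∀ y, ‖f y‖ ≤ B * W y) → 0 ≤ B := fun h =>
    nonneg_of_mul_nonneg_left ((norm_nonneg _).trans (h 0)) (hW0 0)
  have hJi : ∀ {f : ℝ → E} {B : ℝ}, Continuous f → (∀ y, ‖f y‖ ≤ B * W y) → ∀ x,
      IntegrableOn (fun y => A x y (f y)) (Ioi 0) := fun {f B} hf hB x =>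
    (integral_exp_neg_mul_weight hγ hl (M * B) 0 (mul_nonneg hM (hBnn hB))).1.mono' (hJm hf x)
      ((ae_restrict_iff' measurableSet_Ioi).2 (Eventually.of_forall fun y hy => hle hB x y hy))
  have hJb : ∀ {f : ℝ → E} {B : ℝ}, (∀ y, ‖f y‖ ≤ B * W y) → ∀ x,
      ‖∫ y in Ioi 0, A x y (f y)‖ ≤ B / 2 * W x := by
    intro f B hB x
    have hB0 := hBnn hB
    rw [setIntegral_Ioi_zero_eq_of_forall_le (le_max_right x 0)]
    · obtain ⟨h1, h2⟩ := integral_exp_neg_mul_weight hγ hl (M * B) (max x 0) (mul_nonneg hM hB0)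
      refine (norm_integral_le_of_norm_le h1 ((ae_restrict_iff' measurableSet_Ioi).2
        (Eventually.of_forall fun y hy => hle hB x y ((le_max_right x 0).trans_lt hy)))).trans ?_
      rw [h2]
      have h3 : M * B / (γ * l) ≤ B / 2 := by
        rw [div_le_div_iff₀ (by positivity) two_pos]
        nlinarith
      exact mul_le_mul h3 (by simp [hW]) (by have := hW1 x; simpa [hW] using this) (by positivity)
    · intro y hy hyx
      have h : y ≤ x := (le_max_iff.1 hyx).resolve_right (not_le.2 hy)
      simp [hzero x y h]
  have hJc : ∀ {f : ℝ → E} {B : ℝ}, Continuous f → (∀ y, ‖f y‖ ≤ B * W y) →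
      Continuous fun x => ∫ y in Ioi 0, A x y (f y) := fun {f B} hf hB =>
    continuous_of_dominated (hJm hf)
      (fun x => (ae_restrict_iff' measurableSet_Ioi).2
        (Eventually.of_forall fun y hy => hle hB x y hy))
      (integral_exp_neg_mul_weight hγ hl (M * B) 0 (mul_nonneg hM (hBnn hB))).1
      ((ae_restrict_iff' measurableSet_Ioi).2
        (Eventually.of_forall fun y hy => (hcont y hy).clm_apply continuous_const))
  have hwB : ∀ (w : ℝ →ᵇ E) (y : ℝ), ‖W y • w y‖ ≤ ‖w‖ * W y := fun w y => by
    rw [norm_smul, norm_of_nonneg (hW0 y).le, mul_comm]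
    exact mul_le_mul_of_nonneg_right (w.norm_coe_le_norm y) (hW0 y).le
  have hwc : ∀ w : ℝ →ᵇ E, Continuous fun y => W y • w y := fun w => hWc.smul w.continuous
  have hSb : ∀ (w : ℝ →ᵇ E) (x : ℝ),
      ‖(W x)⁻¹ • (a + ∫ y in Ioi 0, A x y (W y • w y))‖ ≤ ‖a‖ + ‖w‖ / 2 := fun w x => by
    rw [norm_smul, norm_inv, norm_of_nonneg (hW0 x).le, inv_mul_le_iff₀ (hW0 x)]
    have h1 := hJb (hwB w) x
    have h2 := le_mul_of_one_le_left (norm_nonneg a) (hW1 x)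
    calc _ ≤ ‖a‖ + ‖w‖ / 2 * W x := (norm_add_le _ _).trans (by gcongr)
      _ ≤ _ := by linarith
  let S : (ℝ →ᵇ E) → (ℝ →ᵇ E) := fun w =>
    BoundedContinuousFunction.ofNormedAddCommGroup
      (fun x => (W x)⁻¹ • (a + ∫ y in Ioi 0, A x y (W y • w y)))
      ((hWc.inv₀ fun x => (hW0 x).ne').smul (continuous_const.add (hJc (hwc w) (hwB w))))
      (‖a‖ + ‖w‖ / 2) (hSb w)
  have hS : ∀ w x, S w x = (W x)⁻¹ • (a + ∫ y in Ioi 0, A x y (W y • w y)) := fun _ _ => rfl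
  have hcontr : ContractingWith (1 / 2) S := by
    refine ⟨by rw [← NNReal.coe_lt_coe]; norm_num, LipschitzWith.of_dist_le_mul fun w v => ?_⟩
    rw [BoundedContinuousFunction.dist_le (by positivity)]
    intro x
    rw [dist_eq_norm, hS, hS, ← smul_sub, add_sub_add_left_eq_sub,
      ← integral_sub (hJi (hwc w) (hwB w) x) (hJi (hwc v) (hwB v) x), norm_smul, norm_inv,
      norm_of_nonneg (hW0 x).le, inv_mul_le_iff₀ (hW0 x)]
    have h := hJb (hwB (w - v)) x
    simp only [BoundedContinuousFunction.coe_sub, Pi.sub_apply, smul_sub, map_sub] at h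
    rw [dist_eq_norm]
    refine h.trans_eq ?_
    push_cast
    ring
  obtain ⟨w, hw⟩ : ∃ w, S w = w := ⟨_, hcontr.fixedPoint_isFixedPt⟩
  have hwn : ‖w‖ ≤ 2 * ‖a‖ := by
    have : ‖w‖ ≤ ‖a‖ + ‖w‖ / 2 := by
      conv_lhs => rw [← hw]
      exact BoundedContinuousFunction.norm_ofNormedAddCommGroup_le _ (by positivity) (hSb w)
    linarith
  refine ⟨fun y => W y • w y, hwc w, fun x => ?_, hJi (hwc w) (hwB w), fun x => ?_⟩
  · refine (hwB w x).trans ?_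
    calc ‖w‖ * W x ≤ (2 * ‖a‖) * exp l := mul_le_mul hwn (hWl x) (hW0 x).le (by positivity)
      _ = _ := by ring
  · have h := hS w x
    rw [hw] at h
    change W x • w x = _
    rw [h, smul_inv_smul₀ (hW0 x).ne']

end Volterra

section Uniqueness

/-- An exponential bound on a function and its second derivative controls the first derivative. -/
theorem norm_deriv_le_of_norm_le_of_norm_deriv_deriv_le {F : Type*} [NormedAddCommGroup F]
    [NormedSpace ℝ F] {h h' h'' : ℝ → F} {m B B' : ℝ} (hm : 0 ≤ m) (hB : 0 ≤ B) (hB' : 0 ≤ B')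
    (hd : ∀ x, 0 < x → HasDerivAt h (h' x) x) (hd' : ∀ x, 0 < x → HasDerivAt h' (h'' x) x)
    (hb : ∀ x, 0 < x → ‖h x‖ ≤ B * exp (-m * x))
    (hb'' : ∀ x, 0 < x → ‖h'' x‖ ≤ B' * exp (-m * x)) {x : ℝ} (hx : 0 < x) :
    ‖h' x‖ ≤ (2 * B + B') * exp (-m * x) := by
  have hdec : ∀ t, x ≤ t → exp (-m * t) ≤ exp (-m * x) := fun t ht =>
    exp_le_exp.2 (by nlinarith)
  have h1 : ∀ t ∈ Icc x (x + 1), ‖h' t - h' x‖ ≤ B' * exp (-m * x) := fun t ht => by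
    have h0 : 0 ≤ B' * exp (-m * x) := by positivity
    refine ((convex_Icc x (x + 1)).norm_image_sub_le_of_norm_hasDerivWithin_le
      (fun s hs => (hd' s (hx.trans_le hs.1)).hasDerivWithinAt)
      (fun s hs => (hb'' s (hx.trans_le hs.1)).trans
        (mul_le_mul_of_nonneg_left (hdec s hs.1) hB'))
      (left_mem_Icc.2 (by linarith)) ht).trans ?_
    rw [norm_of_nonneg (by linarith [ht.1])]
    exact mul_le_of_le_one_right h0 (by linarith [ht.2])
  have h2 := (convex_Icc x (x + 1)).norm_image_sub_le_of_norm_hasDerivWithin_le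
    (f := fun t => h t - t • h' x) (f' := fun t => h' t - h' x)
    (fun t ht => (((hd t (hx.trans_le ht.1)).sub
      ((hasDerivAt_id t).smul_const (h' x))).congr_deriv (by simp)).hasDerivWithinAt)
    h1 (left_mem_Icc.2 (by linarith)) (right_mem_Icc.2 (by linarith))
  have h3 : h' x = h (x + 1) - h x - ((h (x + 1) - (x + 1) • h' x) - (h x - x • h' x)) := by
    rw [add_smul, one_smul]; abel
  rw [h3]
  have h4 := (hb (x + 1) (by linarith)).trans
    (mul_le_mul_of_nonneg_left (hdec (x + 1) (by linarith)) hB)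
  have h5 := hb x hx
  simp only [add_sub_cancel_left, norm_one, mul_one] at h2
  calc _ ≤ ‖h (x + 1)‖ + ‖h x‖ + _ := norm_sub_le_of_le (norm_sub_le _ _) le_rfl
    _ ≤ _ := by linarith

open scoped InnerProductSpace in
/-- Pointwise lower bound for the derivative of the energy density of one component. -/
theorem neg_le_energy_deriv {F : Type*} [NormedAddCommGroup F] [InnerProductSpace ℝ F]
    {h h' r : F} {k μ : ℝ} (hμ : 0 ≤ μ) (hk : |k + μ ^ 2| ≤ 2 * μ ^ 2) :
    -(2 * μ * (‖h'‖ ^ 2 + μ ^ 2 * ‖h‖ ^ 2) + 2 * ‖h'‖ * ‖r‖) ≤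
      2 * ⟪h', k • h + r⟫_ℝ + μ ^ 2 * (2 * ⟪h, h'⟫_ℝ) := by
  have e : 2 * ⟪h', k • h + r⟫_ℝ + μ ^ 2 * (2 * ⟪h, h'⟫_ℝ) =
      2 * (k + μ ^ 2) * ⟪h, h'⟫_ℝ + 2 * ⟪h', r⟫_ℝ := by
    rw [inner_add_right, inner_smul_right, real_inner_comm h h']; ring
  rw [e]
  have h1 : |(k + μ ^ 2) * ⟪h, h'⟫_ℝ| ≤ 2 * μ ^ 2 * (‖h‖ * ‖h'‖) := by
    rw [abs_mul]
    exact mul_le_mul hk (abs_real_inner_le_norm h h') (abs_nonneg _) (by positivity)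
  have h2 := neg_le_of_abs_le (abs_real_inner_le_norm h' r)
  have h3 := neg_le_of_abs_le h1
  nlinarith [mul_nonneg hμ (sq_nonneg (‖h'‖ - μ * ‖h‖))]

open scoped InnerProductSpace in
/-- A solution of the coupled system that decays faster than `exp (-μ x)` vanishes. -/
theorem eq_zero_of_decay {F : Type*} [NormedAddCommGroup F] [InnerProductSpace ℝ F]
    {h₁ h₁' r₁ h₂ h₂' r₂ : ℝ → F} {k₁ k₂ μ γ B c : ℝ} (hμ : 0 < μ) (hγ : 0 < γ) (hB : 0 ≤ B)
    (hc : 0 ≤ c) (hk₁ : |k₁ + μ ^ 2| ≤ 2 * μ ^ 2) (hk₂ : |k₂ + μ ^ 2| ≤ 2 * μ ^ 2)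
    (hd₁ : ∀ x, 0 < x → HasDerivAt h₁ (h₁' x) x)
    (hd₁' : ∀ x, 0 < x → HasDerivAt h₁' (k₁ • h₁ x + r₁ x) x)
    (hd₂ : ∀ x, 0 < x → HasDerivAt h₂ (h₂' x) x)
    (hd₂' : ∀ x, 0 < x → HasDerivAt h₂' (k₂ • h₂ x + r₂ x) x)
    (hr₁ : ∀ x, 0 < x → ‖r₁ x‖ ≤ c * exp (-γ * x) * (‖h₁ x‖ + ‖h₂ x‖))
    (hr₂ : ∀ x, 0 < x → ‖r₂ x‖ ≤ c * exp (-γ * x) * (‖h₁ x‖ + ‖h₂ x‖))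
    (hb₁ : ∀ x, 0 < x → ‖h₁ x‖ ≤ B * exp (-(μ + γ) * x))
    (hb₂ : ∀ x, 0 < x → ‖h₂ x‖ ≤ B * exp (-(μ + γ) * x)) {x : ℝ} (hx : 0 < x) :
    h₁ x = 0 ∧ h₂ x = 0 := by
  have hsecond : ∀ {h r : ℝ → F} {k : ℝ}, (∀ x, 0 < x → ‖h x‖ ≤ B * exp (-(μ + γ) * x)) →
      (∀ x, 0 < x → ‖r x‖ ≤ c * exp (-γ * x) * (‖h₁ x‖ + ‖h₂ x‖)) →
      ∀ x, 0 < x → ‖k • h x + r x‖ ≤ (|k| * B + c * (2 * B)) * exp (-(μ + γ) * x) := by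
    intro h r k hh hr x hx
    have e1 : exp (-γ * x) ≤ 1 := exp_le_one_iff.2 (by nlinarith)
    have e2 : ‖h₁ x‖ + ‖h₂ x‖ ≤ 2 * B * exp (-(μ + γ) * x) := by
      linarith [hb₁ x hx, hb₂ x hx]
    calc ‖k • h x + r x‖ ≤ |k| * ‖h x‖ + ‖r x‖ := by
          refine (norm_add_le _ _).trans_eq ?_
          rw [norm_smul, Real.norm_eq_abs]
      _ ≤ |k| * (B * exp (-(μ + γ) * x)) + c * 1 * (2 * B * exp (-(μ + γ) * x)) := by
          gcongr
          · exact hh x hx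
          · refine (hr x hx).trans ?_
            gcongr
      _ = _ := by ring
  set Q₁ := 2 * B + (|k₁| * B + c * (2 * B)) with hQ₁
  set Q₂ := 2 * B + (|k₂| * B + c * (2 * B)) with hQ₂
  have hb₁' : ∀ x, 0 < x → ‖h₁' x‖ ≤ Q₁ * exp (-(μ + γ) * x) := fun x hx =>
    norm_deriv_le_of_norm_le_of_norm_deriv_deriv_le (by positivity) hB (by positivity) hd₁ hd₁'
      hb₁ (hsecond hb₁ hr₁) hx
  have hb₂' : ∀ x, 0 < x → ‖h₂' x‖ ≤ Q₂ * exp (-(μ + γ) * x) := fun x hx =>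
    norm_deriv_le_of_norm_le_of_norm_deriv_deriv_le (by positivity) hB (by positivity) hd₂ hd₂'
      hb₂ (hsecond hb₂ hr₂) hx
  set D := 4 * c / μ with hD
  let N : ℝ → ℝ := fun x => ‖h₁' x‖ ^ 2 + μ ^ 2 * ‖h₁ x‖ ^ 2 +
    (‖h₂' x‖ ^ 2 + μ ^ 2 * ‖h₂ x‖ ^ 2)
  let N' : ℝ → ℝ := fun x =>
    2 * ⟪h₁' x, k₁ • h₁ x + r₁ x⟫_ℝ + μ ^ 2 * (2 * ⟪h₁ x, h₁' x⟫_ℝ) +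
    (2 * ⟪h₂' x, k₂ • h₂ x + r₂ x⟫_ℝ + μ ^ 2 * (2 * ⟪h₂ x, h₂' x⟫_ℝ))
  have hN : ∀ x, 0 < x → HasDerivAt N (N' x) x := fun x hx =>
    ((hd₁' x hx).norm_sq.add ((hd₁ x hx).norm_sq.const_mul _)).add
      ((hd₂' x hx).norm_sq.add ((hd₂ x hx).norm_sq.const_mul _))
  have hN0 : ∀ x, 0 ≤ N x := fun x => by positivity
  have hN' : ∀ x, 0 < x → 0 ≤ N' x + (2 * μ + D * exp (-γ * x)) * N x := by
    intro x hx
    have i1 := neg_le_energy_deriv (h := h₁ x) (h' := h₁' x) (r := r₁ x) hμ.le hk₁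
    have i2 := neg_le_energy_deriv (h := h₂ x) (h' := h₂' x) (r := r₂ x) hμ.le hk₂
    have j1 := mul_le_mul_of_nonneg_left (hr₁ x hx) (norm_nonneg (h₁' x))
    have j2 := mul_le_mul_of_nonneg_left (hr₂ x hx) (norm_nonneg (h₂' x))
    have key : 2 * (‖h₁' x‖ + ‖h₂' x‖) * (c * exp (-γ * x) * (‖h₁ x‖ + ‖h₂ x‖)) ≤
        D * exp (-γ * x) * N x := by
      have e : D * exp (-γ * x) * N x = (2 * c * exp (-γ * x) / μ) * (2 * N x) := by
        rw [hD]; ring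
      have e' : 2 * (‖h₁' x‖ + ‖h₂' x‖) * (c * exp (-γ * x) * (‖h₁ x‖ + ‖h₂ x‖)) =
          (2 * c * exp (-γ * x) / μ) * ((‖h₁' x‖ + ‖h₂' x‖) * (μ * ‖h₁ x‖ + μ * ‖h₂ x‖)) := by
        field_simp
      rw [e, e']
      refine mul_le_mul_of_nonneg_left ?_ (by positivity)
      simp only [N]
      nlinarith [sq_nonneg (‖h₁' x‖ - μ * ‖h₁ x‖), sq_nonneg (‖h₁' x‖ - μ * ‖h₂ x‖),
        sq_nonneg (‖h₂' x‖ - μ * ‖h₁ x‖), sq_nonneg (‖h₂' x‖ - μ * ‖h₂ x‖)]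
    simp only [N', N] at *
    linarith
  let G : ℝ → ℝ := fun x => N x * exp (2 * μ * x - D / γ * exp (-γ * x))
  have hG : ∀ x, 0 < x → HasDerivAt G ((N' x + (2 * μ + D * exp (-γ * x)) * N x) *
      exp (2 * μ * x - D / γ * exp (-γ * x))) x := by
    intro x hx
    refine ((hN x hx).mul (((hasDerivAt_id x).const_mul (2 * μ)).sub
      (((hasDerivAt_id x).const_mul (-γ)).exp.const_mul (D / γ))).exp).congr_deriv ?_
    have e : D / γ * (exp (-γ * x) * -γ) = -(D * exp (-γ * x)) := by field_simp
    simp only [id, mul_one, Pi.sub_apply, e]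
    ring
  have hmono : MonotoneOn G (Ioi 0) := by
    refine monotoneOn_of_deriv_nonneg (convex_Ioi 0)
      (fun x hx => (hG x hx).continuousAt.continuousWithinAt) ?_ ?_
    · rw [interior_Ioi]
      exact fun x hx => (hG x hx).differentiableAt.differentiableWithinAt
    · rw [interior_Ioi]
      intro x hx
      rw [(hG x hx).deriv]
      exact mul_nonneg (hN' x hx) (exp_pos _).le
  set R := Q₁ ^ 2 + μ ^ 2 * B ^ 2 + (Q₂ ^ 2 + μ ^ 2 * B ^ 2) with hR
  have hGle : ∀ x, 0 < x → G x ≤ R * exp (-(2 * γ) * x) := by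
    intro x hx
    have i1 := pow_le_pow_left₀ (norm_nonneg _) (hb₁ x hx) 2
    have i2 := pow_le_pow_left₀ (norm_nonneg _) (hb₂ x hx) 2
    have i3 := pow_le_pow_left₀ (norm_nonneg _) (hb₁' x hx) 2
    have i4 := pow_le_pow_left₀ (norm_nonneg _) (hb₂' x hx) 2
    have hNle : N x ≤ R * exp (-(μ + γ) * x) ^ 2 := by
      simp only [mul_pow] at i1 i2 i3 i4
      have := mul_le_mul_of_nonneg_left i1 (sq_nonneg μ)
      have := mul_le_mul_of_nonneg_left i2 (sq_nonneg μ)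
      simp only [N, hR]
      linarith
    have hexp : exp (2 * μ * x - D / γ * exp (-γ * x)) ≤ exp (2 * μ * x) :=
      exp_le_exp.2 (sub_le_self _ (by positivity))
    calc G x ≤ (R * exp (-(μ + γ) * x) ^ 2) * exp (2 * μ * x) :=
          mul_le_mul hNle hexp (exp_pos _).le (by positivity)
      _ = R * exp (-(2 * γ) * x) := by
          rw [← exp_nat_mul, mul_assoc, ← exp_add]
          congr 2
          push_cast
          ring
  have hlim : Tendsto (fun x => R * exp (-(2 * γ) * x)) atTop (𝓝 0) := by
    have : Tendsto (fun x => exp (-(2 * γ) * x)) atTop (𝓝 0) :=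
      tendsto_exp_atBot.comp (tendsto_id.const_mul_atTop_of_neg (by linarith))
    simpa using this.const_mul R
  have hG0 : G x ≤ 0 := ge_of_tendsto hlim <| (eventually_ge_atTop x).mono fun y hy =>
    (hmono hx (hx.trans_le hy) hy).trans (hGle y (hx.trans_le hy))
  have hNx : N x = 0 := le_antisymm (nonpos_of_mul_nonpos_left hG0 (exp_pos _)) (hN0 x)
  have hsq : ∀ {v : F}, μ ^ 2 * ‖v‖ ^ 2 ≤ 0 → v = 0 := fun {v} hv => by
    have := nonpos_of_mul_nonpos_right hv (by positivity)
    exact norm_eq_zero.1 (pow_eq_zero_iff two_ne_zero |>.1 (le_antisymm this (sq_nonneg _)))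
  simp only [N] at hNx
  constructor <;> refine hsq ?_ <;>
    nlinarith [sq_nonneg ‖h₁' x‖, sq_nonneg ‖h₂' x‖, sq_nonneg (μ * ‖h₁ x‖),
      sq_nonneg (μ * ‖h₂ x‖)]

end Uniqueness

section Existence

theorem integrableOn_Ioi_of_abs_le_exp {h : ℝ → ℝ} {γ B : ℝ} (hγ : 0 < γ)
    (hc : ContinuousOn h (Ioi 0)) (hb : ∀ y, 0 < y → |h y| ≤ B * exp (-γ * y)) :
    IntegrableOn h (Ioi 0) :=
  (integrableOn_const_mul_exp_neg hγ B 0).mono' (hc.aestronglyMeasurable measurableSet_Ioi)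
    ((ae_restrict_iff' measurableSet_Ioi).2 (Eventually.of_forall hb))

theorem hasDerivAt_integral_Ioi {h : ℝ → ℝ} (hc : ContinuousOn h (Ioi 0))
    (hi : IntegrableOn h (Ioi 0)) {x : ℝ} (hx : 0 < x) :
    HasDerivAt (fun x => ∫ y in Ioi x, h y) (-h x) x := by
  have hint : IntervalIntegrable h volume 0 x :=
    (intervalIntegrable_iff_integrableOn_Ioc_of_le hx.le).2 (hi.mono_set Ioc_subset_Ioi_self)
  have h1 : HasDerivAt (fun x => ∫ y in (0 : ℝ)..x, h y) (h x) x :=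
    intervalIntegral.integral_hasDerivAt_right hint
      (hc.stronglyMeasurableAtFilter isOpen_Ioi x hx) (hc.continuousAt (Ioi_mem_nhds hx))
  have h2 := h1.const_sub (∫ y in Ioi 0, h y)
  refine h2.congr_of_eventuallyEq ?_
  filter_upwards [Ioi_mem_nhds hx] with z hz
  rw [← intervalIntegral.integral_Ioi_sub_Ioi hi (le_of_lt hz), sub_sub_cancel]

/-- Variation of parameters for `f'' = k f + G`, with the integrals taken from `+∞`. -/
theorem exists_variation_of_parameters {p p' q q' G : ℝ → ℝ} {k : ℝ}
    (hp : ∀ x, HasDerivAt p (p' x) x) (hp' : ∀ x, HasDerivAt p' (k * p x) x)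
    (hq : ∀ x, HasDerivAt q (q' x) x) (hq' : ∀ x, HasDerivAt q' (k * q x) x)
    (hW : ∀ x, p x * q' x - p' x * q x = 1) (hG : ContinuousOn G (Ioi 0))
    (hpi : IntegrableOn (fun y => p y * G y) (Ioi 0))
    (hqi : IntegrableOn (fun y => q y * G y) (Ioi 0)) :
    ∃ f f' : ℝ → ℝ, (∀ x, 0 < x → HasDerivAt f (f' x) x) ∧
      (∀ x, 0 < x → HasDerivAt f' (k * f x + G x) x) ∧
      ∀ x, 0 < x → f x = ∫ y in Ioi x, (p x * q y - q x * p y) * G y := by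
  have hpc : Continuous p := continuous_iff_continuousAt.2 fun x => (hp x).continuousAt
  have hqc : Continuous q := continuous_iff_continuousAt.2 fun x => (hq x).continuousAt
  have hP : ∀ x, 0 < x → HasDerivAt (fun x => ∫ y in Ioi x, p y * G y) (-(p x * G x)) x :=
    fun x => hasDerivAt_integral_Ioi (hpc.continuousOn.mul hG) hpi
  have hQ : ∀ x, 0 < x → HasDerivAt (fun x => ∫ y in Ioi x, q y * G y) (-(q x * G x)) x :=
    fun x => hasDerivAt_integral_Ioi (hqc.continuousOn.mul hG) hqi
  refine ⟨fun x => p x * (∫ y in Ioi x, q y * G y) - q x * ∫ y in Ioi x, p y * G y,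
    fun x => p' x * (∫ y in Ioi x, q y * G y) - q' x * ∫ y in Ioi x, p y * G y,
    fun x hx => ?_, fun x hx => ?_, fun x hx => ?_⟩
  · refine (((hp x).mul (hQ x hx)).sub ((hq x).mul (hP x hx))).congr_deriv ?_
    ring
  · refine (((hp' x).mul (hQ x hx)).sub ((hq' x).mul (hP x hx))).congr_deriv ?_
    linear_combination G x * hW x
  · beta_reduce
    rw [← integral_const_mul, ← integral_const_mul, ← integral_sub]
    · exact integral_congr_ae (Eventually.of_forall fun y => by ring)
    · exact (hqi.mono_set (Ioi_subset_Ioi hx.le)).const_mul _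
    · exact (hpi.mono_set (Ioi_subset_Ioi hx.le)).const_mul _

/-- The function `sin (ξ x) / ξ`, read as `x` when `ξ = 0`. -/
theorem exists_sin_mul_div (ξ : ℝ) : ∃ s : ℝ → ℝ, (∀ x, HasDerivAt s (cos (ξ * x)) x) ∧
    (∀ x, ξ * s x = sin (ξ * x)) ∧ (∀ x, |s x| ≤ |x|) ∧
    ∀ x y, s (y - x) = cos (ξ * x) * s y - s x * cos (ξ * y) := by
  rcases eq_or_ne ξ 0 with rfl | hξ
  · exact ⟨fun x => x, fun x => by simpa using hasDerivAt_id' x, by simp, by simp, by simp⟩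
  · refine ⟨fun x => sin (ξ * x) / ξ, fun x => ?_, fun x => by field_simp, fun x => ?_,
      fun x y => ?_⟩
    · refine (((hasDerivAt_id x).const_mul ξ).sin.div_const ξ).congr_deriv ?_
      simp only [id]
      field_simp
    · rw [abs_div, div_le_iff₀ (abs_pos.2 hξ), mul_comm, ← abs_mul]
      exact abs_sin_le_abs
    · beta_reduce
      rw [mul_sub, sin_sub]
      ring

theorem exists_real_decaying_solution {ξ μ γ C0 l : ℝ} {V1 V2 : ℝ → ℝ} (hμ : 0 < μ) (hγ : 0 < γ)
    (hC0 : 0 < C0) (hl : 0 < l) (hl' : 2 * (2 * C0 / μ) ≤ γ * l)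
    (hV1 : ContinuousOn V1 (Ioi 0)) (hV2 : ContinuousOn V2 (Ioi 0))
    (hV : ∀ x : ℝ, 0 < x → |V1 x| + |V2 x| ≤ C0 * exp (-γ * x)) :
    ∃ f₁ f₁' f₂ f₂' : ℝ → ℝ, (∀ x, 0 < x → HasDerivAt f₁ (f₁' x) x) ∧
      (∀ x, 0 < x → HasDerivAt f₁' (-ξ ^ 2 * f₁ x + 2 * (V1 x * f₁ x + V2 x * f₂ x)) x) ∧
      (∀ x, 0 < x → HasDerivAt f₂ (f₂' x) x) ∧
      (∀ x, 0 < x → HasDerivAt f₂' (μ ^ 2 * f₂ x + 2 * (V1 x * f₂ x + V2 x * f₁ x)) x) ∧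
      ∀ x, 0 < x → |exp (μ * x) * f₁ x| ≤ 4 * C0 * exp l / γ * μ⁻¹ * exp (-γ * x) ∧
        |exp (μ * x) * f₂ x - 1| ≤ 4 * C0 * exp l / γ * μ⁻¹ * exp (-γ * x) := by
  obtain ⟨s, hs, hsξ, hsle, hsadd⟩ := exists_sin_mul_div ξ
  have hsc : Continuous s := continuous_iff_continuousAt.2 fun x => (hs x).continuousAt
  have hs0 : s 0 = 0 := by simpa using hsle 0
  have hsexp : ∀ t, 0 ≤ t → |exp (-(μ * t)) * s t| ≤ μ⁻¹ := fun t ht => by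
    rw [abs_mul, abs_of_pos (exp_pos _), exp_neg, inv_mul_le_iff₀ (exp_pos _),
      le_mul_inv_iff₀ hμ, mul_comm]
    have h1 := hsle t
    rw [abs_of_nonneg ht] at h1
    have h2 := add_one_le_exp (μ * t)
    nlinarith
  set κ₁ : ℝ → ℝ := fun t => exp (-(μ * max t 0)) * s (max t 0) with hκ₁
  set κ₂ : ℝ → ℝ := fun t => (1 - exp (-(2 * μ * max t 0))) / (2 * μ) with hκ₂
  have hκ₁c : Continuous κ₁ := by fun_prop
  have hκ₂c : Continuous κ₂ := by fun_prop
  have hκ₁b : ∀ t, |κ₁ t| ≤ μ⁻¹ := fun t => hsexp _ (le_max_right t 0)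
  have hκ₂b : ∀ t, |κ₂ t| ≤ μ⁻¹ := fun t => by
    have h1 : exp (-(2 * μ * max t 0)) ≤ 1 :=
      exp_le_one_iff.2 (neg_nonpos.2 (mul_nonneg (by positivity) (le_max_right t 0)))
    have h2 := exp_pos (-(2 * μ * max t 0))
    simp only [hκ₂]
    rw [abs_of_nonneg (div_nonneg (by linarith) (by positivity)), div_le_iff₀ (by positivity)]
    field_simp
    linarith
  let A : ℝ → ℝ → (ℝ × ℝ →L[ℝ] ℝ × ℝ) := fun x y =>
    κ₁ (y - x) • ((2 * V1 y) • (ContinuousLinearMap.fst ℝ ℝ ℝ).prod 0 +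
      (2 * V2 y) • (ContinuousLinearMap.snd ℝ ℝ ℝ).prod 0) +
    κ₂ (y - x) • ((2 * V1 y) • (0 : ℝ × ℝ →L[ℝ] ℝ).prod (ContinuousLinearMap.snd ℝ ℝ ℝ) +
      (2 * V2 y) • (0 : ℝ × ℝ →L[ℝ] ℝ).prod (ContinuousLinearMap.fst ℝ ℝ ℝ))
  have hA : ∀ x y v, A x y v = (κ₁ (y - x) * (2 * V1 y * v.1 + 2 * V2 y * v.2),
      κ₂ (y - x) * (2 * V1 y * v.2 + 2 * V2 y * v.1)) := fun x y v => by
    simp [A, mul_add]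
  have hg : ∀ {y b c B : ℝ}, 0 < y → |b| ≤ B → |c| ≤ B →
      |2 * V1 y * b + 2 * V2 y * c| ≤ 2 * C0 * B * exp (-γ * y) := fun {y b c B} hy hb hc => by
    have hB : 0 ≤ B := (abs_nonneg b).trans hb
    calc |2 * V1 y * b + 2 * V2 y * c| ≤ 2 * |V1 y| * |b| + 2 * |V2 y| * |c| := by
          refine (abs_add_le _ _).trans_eq ?_
          simp [abs_mul]
      _ ≤ 2 * |V1 y| * B + 2 * |V2 y| * B := by gcongr
      _ = 2 * B * (|V1 y| + |V2 y|) := by ring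
      _ ≤ 2 * B * (C0 * exp (-γ * y)) := by gcongr; exact hV y hy
      _ = _ := by ring
  have hAb : ∀ x y, 0 < y → ‖A x y‖ ≤ 2 * C0 / μ * exp (-γ * y) := fun x y hy => by
    refine ContinuousLinearMap.opNorm_le_bound _ (by positivity) fun v => ?_
    have h1 : |v.1| ≤ ‖v‖ := norm_fst_le v
    have h2 : |v.2| ≤ ‖v‖ := norm_snd_le v
    have e : 2 * C0 / μ * exp (-γ * y) * ‖v‖ = μ⁻¹ * (2 * C0 * ‖v‖ * exp (-γ * y)) := by
      field_simp
    rw [hA, e, Prod.norm_def]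
    refine max_le ?_ ?_
    · rw [Real.norm_eq_abs, abs_mul]
      exact mul_le_mul (hκ₁b _) (hg hy h1 h2) (abs_nonneg _) (by positivity)
    · rw [Real.norm_eq_abs, abs_mul]
      exact mul_le_mul (hκ₂b _) (hg hy h2 h1) (abs_nonneg _) (by positivity)
  have hA0 : ∀ x y, y ≤ x → A x y = 0 := fun x y hyx => by
    have : max (y - x) 0 = 0 := max_eq_right (by linarith)
    simp [A, hκ₁, hκ₂, this, hs0]
  have hAm : ∀ x, AEStronglyMeasurable (A x) (volume.restrict (Ioi 0)) := fun x => by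
    refine ContinuousOn.aestronglyMeasurable ?_ measurableSet_Ioi
    fun_prop
  obtain ⟨u, huc, hub, hui, hu⟩ := exists_volterra_solution hγ hl (by positivity) hl'
    (fun y _ => by fun_prop) hAm hA0 hAb ((0, 1) : ℝ × ℝ)
  have hnorm : ‖((0, 1) : ℝ × ℝ)‖ = 1 := by simp [Prod.norm_def]
  rw [hnorm] at hub
  have hest : ∀ x, 0 < x →
      ‖u x - (0, 1)‖ ≤ 4 * C0 * exp l / γ * μ⁻¹ * exp (-γ * x) := fun x hx => by
    rw [hu x, add_sub_cancel_left, setIntegral_Ioi_zero_eq_of_forall_le hx.le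
      fun y _ h => by simp [hA0 x y h]]
    refine (norm_integral_le_of_norm_le
      (integrableOn_const_mul_exp_neg hγ (4 * C0 * exp l * μ⁻¹) x)
      ((ae_restrict_iff' measurableSet_Ioi).2 (Eventually.of_forall fun y hy => ?_))).trans_eq ?_
    · calc ‖A x y (u y)‖ ≤ 2 * C0 / μ * exp (-γ * y) * (2 * exp l * 1) :=
            ((A x y).le_opNorm _).trans (mul_le_mul (hAb x y (hx.trans hy)) (hub y)
              (norm_nonneg _) (by positivity))
        _ = _ := by ring
    · rw [integral_const_mul_exp_neg hγ]
      ring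
  have hu1 : ∀ x, 0 < x →
      (u x).1 = ∫ y in Ioi x, κ₁ (y - x) * (2 * V1 y * (u y).1 + 2 * V2 y * (u y).2) := by
    intro x hx
    have h := congrArg Prod.fst (hu x)
    rw [Prod.fst_add, zero_add, fst_integral (hui x)] at h
    rw [h, setIntegral_Ioi_zero_eq_of_forall_le hx.le fun y _ h => by simp [hA0 x y h]]
    simp only [hA]
  have hu2 : ∀ x, 0 < x → (u x).2 =
      1 + ∫ y in Ioi x, κ₂ (y - x) * (2 * V1 y * (u y).2 + 2 * V2 y * (u y).1) := by
    intro x hx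
    have h := congrArg Prod.snd (hu x)
    rw [Prod.snd_add, snd_integral (hui x)] at h
    rw [h, setIntegral_Ioi_zero_eq_of_forall_le hx.le fun y _ h => by simp [hA0 x y h]]
    simp only [hA]
  have hb1 : ∀ y, |(u y).1| ≤ 2 * exp l * 1 := fun y => (norm_fst_le _).trans (hub y)
  have hb2 : ∀ y, |(u y).2| ≤ 2 * exp l * 1 := fun y => (norm_snd_le _).trans (hub y)
  set G₁ : ℝ → ℝ := fun y => exp (-(μ * y)) * (2 * V1 y * (u y).1 + 2 * V2 y * (u y).2) with hG₁
  set G₂ : ℝ → ℝ := fun y => exp (-(μ * y)) * (2 * V1 y * (u y).2 + 2 * V2 y * (u y).1) with hG₂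
  have hG₁c : ContinuousOn G₁ (Ioi 0) := by fun_prop
  have hG₂c : ContinuousOn G₂ (Ioi 0) := by fun_prop
  have hint : ∀ {p g : ℝ → ℝ} {B D : ℝ}, ContinuousOn (fun y => p y * (exp (-(μ * y)) * g y))
      (Ioi 0) → (∀ y, 0 < y → |exp (-(μ * y)) * p y| ≤ B) →
      (∀ y, 0 < y → |g y| ≤ D * exp (-γ * y)) →
      IntegrableOn (fun y => p y * (exp (-(μ * y)) * g y)) (Ioi 0) := fun {p g B D} hc hp hg =>
    integrableOn_Ioi_of_abs_le_exp (B := B * D) hγ hc fun y hy => by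
      have e : p y * (exp (-(μ * y)) * g y) = (exp (-(μ * y)) * p y) * g y := by ring
      rw [e, abs_mul, mul_assoc]
      exact mul_le_mul (hp y hy) (hg y hy) (abs_nonneg _) ((abs_nonneg _).trans (hp y hy))
  have hcos : ∀ y, 0 < y → |exp (-(μ * y)) * cos (ξ * y)| ≤ 1 := fun y hy => by
    rw [abs_mul, abs_of_pos (exp_pos _)]
    exact mul_le_one₀ (exp_le_one_iff.2 (neg_nonpos.2 (by positivity))) (abs_nonneg _)
      (abs_cos_le_one _)
  obtain ⟨f₁, f₁', hf₁, hf₁', hf₁u⟩ := exists_variation_of_parameters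
    (p := fun x => cos (ξ * x)) (p' := fun x => -(ξ ^ 2) * s x) (q := s)
    (q' := fun x => cos (ξ * x)) (G := G₁) (k := -ξ ^ 2)
    (fun x => (((hasDerivAt_id x).const_mul ξ).cos).congr_deriv (by
      simp only [id]; linear_combination ξ * hsξ x))
    (fun x => (hs x).const_mul _) hs
    (fun x => (((hasDerivAt_id x).const_mul ξ).cos).congr_deriv (by
      simp only [id]; linear_combination ξ * hsξ x))
    (fun x => by
      have := hsξ x
      have h2 := sin_sq_add_cos_sq (ξ * x)
      rw [← this] at h2
      linear_combination h2)
    hG₁c (hint (by fun_prop) hcos fun y hy => hg hy (hb1 y) (hb2 y))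
    (hint (by fun_prop) (fun y hy => hsexp y hy.le) fun y hy => hg hy (hb1 y) (hb2 y))
  have hdexp : ∀ a x : ℝ, HasDerivAt (fun x => exp (a * x)) (a * exp (a * x)) x := fun a x =>
    (((hasDerivAt_id x).const_mul a).exp).congr_deriv (by simp only [id]; ring)
  obtain ⟨φ, φ', hφ, hφ', hφu⟩ := exists_variation_of_parameters
    (p := fun x => exp (-μ * x)) (p' := fun x => -μ * exp (-μ * x))
    (q := fun x => (2 * μ)⁻¹ * exp (μ * x)) (q' := fun x => (2 * μ)⁻¹ * (μ * exp (μ * x)))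
    (G := G₂) (k := μ ^ 2)
    (hdexp (-μ)) (fun x => ((hdexp (-μ) x).const_mul (-μ)).congr_deriv (by ring))
    (fun x => (hdexp μ x).const_mul _)
    (fun x => (((hdexp μ x).const_mul μ).const_mul (2 * μ)⁻¹).congr_deriv (by ring))
    (fun x => by
      have : exp (-μ * x) * exp (μ * x) = 1 := by rw [← exp_add]; simp
      have h2 : 2 * μ * (2 * μ)⁻¹ = 1 := mul_inv_cancel₀ (by positivity)
      linear_combination exp (-μ * x) * exp (μ * x) * h2 + this)
    hG₂c (hint (B := 1) (by fun_prop) (fun y hy => by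
        rw [← exp_add, abs_of_pos (exp_pos _)]
        exact exp_le_one_iff.2 (by nlinarith [mul_pos hμ hy]))
      fun y hy => hg hy (hb2 y) (hb1 y))
    (hint (B := (2 * μ)⁻¹) (by fun_prop) (fun y hy => by
        rw [mul_left_comm, ← exp_add, neg_add_cancel, exp_zero, mul_one,
          abs_of_pos (by positivity)])
      fun y hy => hg hy (hb2 y) (hb1 y))
  have hf₁x : ∀ x, 0 < x → exp (μ * x) * f₁ x = (u x).1 := by
    intro x hx
    rw [hf₁u x hx, hu1 x hx, ← integral_const_mul]
    refine setIntegral_congr_fun measurableSet_Ioi fun y hy => ?_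
    have hyx : max (y - x) 0 = y - x := max_eq_left (sub_nonneg.2 (le_of_lt hy))
    have he : exp (-(μ * (y - x))) = exp (μ * x) * exp (-(μ * y)) := by
      rw [← exp_add]; ring_nf
    simp only [hκ₁, hG₁, hyx, hsadd, he]
    ring
  have hf₂x : ∀ x, 0 < x → exp (μ * x) * (exp (-μ * x) + φ x) = (u x).2 := by
    intro x hx
    have h1 : ∀ x, exp (μ * x) * exp (-μ * x) = 1 := fun x => by rw [← exp_add]; simp
    rw [hφu x hx, hu2 x hx, mul_add, h1, ← integral_const_mul]
    congr 1
    refine setIntegral_congr_fun measurableSet_Ioi fun y hy => ?_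
    have hyx : max (y - x) 0 = y - x := max_eq_left (sub_nonneg.2 (le_of_lt hy))
    have he : exp (-(2 * μ * (y - x))) = exp (μ * x) ^ 2 * exp (-μ * y) ^ 2 := by
      rw [← exp_nat_mul, ← exp_nat_mul, ← exp_add]; push_cast; ring_nf
    have he' : exp (-(μ * y)) = exp (-μ * y) := by rw [neg_mul]
    simp only [hκ₂, hG₂, hyx, he, he']
    have h2 := h1 x
    have h3 := h1 y
    linear_combination (2 * μ)⁻¹ * (2 * V1 y * (u y).2 + 2 * V2 y * (u y).1) *
      (exp (μ * y) * exp (-μ * y) * h2 + h3)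
  have hback : ∀ x a b, exp (μ * x) * a = b → exp (-(μ * x)) * b = a := fun x a b h => by
    rw [← h, ← mul_assoc, ← exp_add, neg_add_cancel, exp_zero, one_mul]
  refine ⟨f₁, f₁', fun x => exp (-μ * x) + φ x, fun x => -μ * exp (-μ * x) + φ' x, hf₁, ?_, ?_,
    ?_, ?_⟩
  · intro x hx
    refine (hf₁' x hx).congr_deriv ?_
    have h1 := hback x _ _ (hf₁x x hx)
    have h2 := hback x _ _ (hf₂x x hx)
    simp only [hG₁]
    rw [← h2]
    linear_combination 2 * V1 x * h1
  · exact fun x hx => (hdexp (-μ) x).add (hφ x hx)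
  · intro x hx
    refine (((hdexp (-μ) x).const_mul (-μ)).add (hφ' x hx)).congr_deriv ?_
    have h1 := hback x _ _ (hf₁x x hx)
    have h2 := hback x _ _ (hf₂x x hx)
    simp only [hG₂]
    rw [← h1]
    linear_combination 2 * V1 x * h2
  · intro x hx
    rw [hf₁x x hx, hf₂x x hx]
    have h := hest x hx
    exact ⟨by simpa using (norm_fst_le _).trans h, by simpa using (norm_snd_le _).trans h⟩

end Existence

/-- The second derivatives of a solution of the generalized eigenvalue system. -/
theorem SolvesGEP.hasDerivAt {ξ ω μ : ℝ} {V1 V2 : ℝ → ℝ} {f1 f2 : ℝ → ℂ} {s : Set ℝ}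
    (h : SolvesGEP ξ ω V1 V2 f1 f2 s) (hμ : μ ^ 2 = ξ ^ 2 + 4 * ω) {x : ℝ} (hx : x ∈ s) :
    HasDerivAt f1 (deriv f1 x) x ∧
      HasDerivAt (deriv f1) ((-ξ ^ 2) • f1 x + 2 * (V1 x * f1 x + V2 x * f2 x)) x ∧
      HasDerivAt f2 (deriv f2 x) x ∧
      HasDerivAt (deriv f2) ((μ ^ 2) • f2 x + 2 * (V1 x * f2 x + V2 x * f1 x)) x := by
  obtain ⟨h1, h2, h3, h4⟩ := h.1 x hx
  obtain ⟨e1, e2⟩ := h.2 x hx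
  refine ⟨h1.hasDerivAt, h2.hasDerivAt.congr_deriv ?_, h3.hasDerivAt,
    h4.hasDerivAt.congr_deriv ?_⟩
  · rw [Complex.real_smul]
    push_cast at e1 ⊢
    linear_combination -2 * e1
  · rw [Complex.real_smul, hμ]
    push_cast at e2 ⊢
    linear_combination 2 * e2

theorem solvesGEP_ofReal {ξ ω μ : ℝ} {V1 V2 f₁ f₁' f₂ f₂' : ℝ → ℝ}
    (hμ : μ ^ 2 = ξ ^ 2 + 4 * ω)
    (h₁ : ∀ x, 0 < x → HasDerivAt f₁ (f₁' x) x)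
    (h₁' : ∀ x, 0 < x → HasDerivAt f₁' (-ξ ^ 2 * f₁ x + 2 * (V1 x * f₁ x + V2 x * f₂ x)) x)
    (h₂ : ∀ x, 0 < x → HasDerivAt f₂ (f₂' x) x)
    (h₂' : ∀ x, 0 < x → HasDerivAt f₂' (μ ^ 2 * f₂ x + 2 * (V1 x * f₂ x + V2 x * f₁ x)) x) :
    SolvesGEP ξ ω V1 V2 (fun x => (f₁ x : ℂ)) (fun x => (f₂ x : ℂ)) (Ioi 0) := by
  have hd : ∀ {f f' : ℝ → ℝ} {f'' : ℝ} {x : ℝ}, (∀ x, 0 < x → HasDerivAt f (f' x) x) → 0 < x →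
      HasDerivAt f' f'' x → HasDerivAt (deriv fun x => (f x : ℂ)) (f'' : ℂ) x := by
    intro f f' f'' x h hx h'
    refine h'.ofReal_comp.congr_of_eventuallyEq ?_
    filter_upwards [Ioi_mem_nhds hx] with y hy
    exact (h y hy).ofReal_comp.deriv
  refine ⟨fun x hx => ⟨(h₁ x hx).ofReal_comp.differentiableAt,
    (hd h₁ hx (h₁' x hx)).differentiableAt, (h₂ x hx).ofReal_comp.differentiableAt,
    (hd h₂ hx (h₂' x hx)).differentiableAt⟩, fun x hx => ?_⟩
  rw [(hd h₁ hx (h₁' x hx)).deriv, (hd h₂ hx (h₂' x hx)).deriv, hμ]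
  push_cast
  constructor <;> ring

/-- Two solutions of the generalized eigenvalue system that agree up to `O(exp (-(μ + γ) x))`
coincide. -/
theorem SolvesGEP.eq_of_norm_sub_le {ξ ω μ γ C0 B : ℝ} {V1 V2 : ℝ → ℝ} {f1 f2 g1 g2 : ℝ → ℂ}
    (hf : SolvesGEP ξ ω V1 V2 f1 f2 (Ioi 0)) (hg : SolvesGEP ξ ω V1 V2 g1 g2 (Ioi 0))
    (hω : 0 < ω) (hμ : 0 < μ) (hμ2 : μ ^ 2 = ξ ^ 2 + 4 * ω) (hγ : 0 < γ) (hC0 : 0 ≤ C0)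
    (hB : 0 ≤ B) (hV : ∀ x : ℝ, 0 < x → |V1 x| + |V2 x| ≤ C0 * exp (-γ * x))
    (h1 : ∀ x, 0 < x → ‖g1 x - f1 x‖ ≤ B * exp (-(μ + γ) * x))
    (h2 : ∀ x, 0 < x → ‖g2 x - f2 x‖ ≤ B * exp (-(μ + γ) * x)) {x : ℝ} (hx : 0 < x) :
    g1 x = f1 x ∧ g2 x = f2 x := by
  have hVle : ∀ {x : ℝ}, 0 < x → ∀ a b : ℂ,
      ‖2 * ((V1 x : ℂ) * a + (V2 x : ℂ) * b)‖ ≤ 2 * C0 * exp (-γ * x) * (‖a‖ + ‖b‖) := by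
    intro x hx a b
    have hv := hV x hx
    have hv1 : |V1 x| ≤ C0 * exp (-γ * x) := by linarith [abs_nonneg (V2 x)]
    have hv2 : |V2 x| ≤ C0 * exp (-γ * x) := by linarith [abs_nonneg (V1 x)]
    calc ‖2 * ((V1 x : ℂ) * a + (V2 x : ℂ) * b)‖ ≤ 2 * (|V1 x| * ‖a‖ + |V2 x| * ‖b‖) := by
          rw [norm_mul, Complex.norm_ofNat]
          gcongr
          refine (norm_add_le _ _).trans_eq ?_
          simp
      _ ≤ 2 * (C0 * exp (-γ * x) * ‖a‖ + C0 * exp (-γ * x) * ‖b‖) := by gcongr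
      _ = _ := by ring
  have key := eq_zero_of_decay (F := ℂ) (h₁ := fun x => g1 x - f1 x)
    (h₂ := fun x => g2 x - f2 x) (h₁' := fun x => deriv g1 x - deriv f1 x)
    (h₂' := fun x => deriv g2 x - deriv f2 x)
    (r₁ := fun x => 2 * (V1 x * (g1 x - f1 x) + V2 x * (g2 x - f2 x)))
    (r₂ := fun x => 2 * (V1 x * (g2 x - f2 x) + V2 x * (g1 x - f1 x)))
    (k₁ := -ξ ^ 2) (k₂ := μ ^ 2) (c := 2 * C0) hμ hγ hB (by positivity)
    (by rw [hμ2, abs_of_nonneg] <;> nlinarith [sq_nonneg ξ])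
    (by rw [abs_of_nonneg] <;> nlinarith [sq_nonneg μ])
    (fun x hx => (hg.hasDerivAt hμ2 hx).1.sub (hf.hasDerivAt hμ2 hx).1)
    (fun x hx => ((hg.hasDerivAt hμ2 hx).2.1.sub (hf.hasDerivAt hμ2 hx).2.1).congr_deriv (by
      rw [smul_sub]; ring))
    (fun x hx => (hg.hasDerivAt hμ2 hx).2.2.1.sub (hf.hasDerivAt hμ2 hx).2.2.1)
    (fun x hx => ((hg.hasDerivAt hμ2 hx).2.2.2.sub (hf.hasDerivAt hμ2 hx).2.2.2).congr_deriv (by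
      rw [smul_sub]; ring))
    (fun x hx => hVle hx _ _)
    (fun x hx => (hVle hx _ _).trans_eq (by ring)) h1 h2 hx
  exact ⟨sub_eq_zero.1 key.1, sub_eq_zero.1 key.2⟩

theorem norm_sub_le_of_exp_mul {μ γ B B' x : ℝ} {a b e : ℂ}
    (ha : ‖(exp (μ * x) : ℂ) * a - e‖ ≤ B * exp (-γ * x))
    (hb : ‖(exp (μ * x) : ℂ) * b - e‖ ≤ B' * exp (-γ * x)) :
    ‖a - b‖ ≤ (B + B') * exp (-(μ + γ) * x) := by
  have h : ‖(exp (μ * x) : ℂ) * (a - b)‖ ≤ (B + B') * exp (-γ * x) := by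
    have e1 : (exp (μ * x) : ℂ) * (a - b) =
        ((exp (μ * x) : ℂ) * a - e) - ((exp (μ * x) : ℂ) * b - e) := by ring
    rw [e1]
    refine (norm_sub_le _ _).trans ?_
    linarith
  rw [norm_mul, Complex.norm_real, norm_of_nonneg (exp_pos _).le] at h
  have e2 : exp (-γ * x) = exp (μ * x) * exp (-(μ + γ) * x) := by
    rw [← exp_add]; ring_nf
  rw [e2, mul_left_comm] at h
  exact le_of_mul_le_mul_left h (exp_pos _)

theorem statement15 (ω γ C0 : ℝ) (hω : 0 < ω) (hγ : 0 < γ) (hC0 : 0 < C0) :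
    ∃ C : ℝ, 0 < C ∧ ∀ ξ : ℝ, ∀ V1 V2 : ℝ → ℝ,
      ContDiffOn ℝ (⊤ : ℕ∞) V1 (Set.Ioi 0) → ContDiffOn ℝ (⊤ : ℕ∞) V2 (Set.Ioi 0) →
      (∀ x : ℝ, 0 < x → |V1 x| + |V2 x| ≤ C0 * Real.exp (-γ * x)) →
      ∃ f31 f32 : ℝ → ℂ,
        SolvesGEP ξ ω V1 V2 f31 f32 (Set.Ioi 0) ∧
        (∀ x : ℝ, 0 < x →
          ‖(Real.exp (Real.sqrt (ξ ^ 2 + 4 * ω) * x) : ℂ) * f31 x‖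
            ≤ C * (Real.sqrt (ξ ^ 2 + 4 * ω))⁻¹ * Real.exp (-γ * x) ∧
          ‖(Real.exp (Real.sqrt (ξ ^ 2 + 4 * ω) * x) : ℂ) * f32 x - 1‖
            ≤ C * (Real.sqrt (ξ ^ 2 + 4 * ω))⁻¹ * Real.exp (-γ * x)) ∧
        (∀ g1 g2 : ℝ → ℂ, SolvesGEP ξ ω V1 V2 g1 g2 (Set.Ioi 0) →
          (∃ C' : ℝ, 0 < C' ∧ ∀ x : ℝ, 0 < x →
            ‖(Real.exp (Real.sqrt (ξ ^ 2 + 4 * ω) * x) : ℂ) * g1 x‖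
              ≤ C' * (Real.sqrt (ξ ^ 2 + 4 * ω))⁻¹ * Real.exp (-γ * x) ∧
            ‖(Real.exp (Real.sqrt (ξ ^ 2 + 4 * ω) * x) : ℂ) * g2 x - 1‖
              ≤ C' * (Real.sqrt (ξ ^ 2 + 4 * ω))⁻¹ * Real.exp (-γ * x)) →
          ∀ x : ℝ, 0 < x → g1 x = f31 x ∧ g2 x = f32 x) := by
  set l := 4 * C0 / (γ * √ω) with hl
  have hl0 : 0 < l := by positivity
  refine ⟨4 * C0 * exp l / γ, by positivity, fun ξ V1 V2 hV1 hV2 hV => ?_⟩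
  set μ := √(ξ ^ 2 + 4 * ω) with hμ
  have hμ0 : 0 < μ := by positivity
  have hμ2 : μ ^ 2 = ξ ^ 2 + 4 * ω := sq_sqrt (by positivity)
  have hωμ : √ω ≤ μ := sqrt_le_sqrt (by nlinarith [sq_nonneg ξ])
  have hl' : 2 * (2 * C0 / μ) ≤ γ * l := by
    calc 2 * (2 * C0 / μ) = 4 * C0 / μ := by ring
      _ ≤ 4 * C0 / √ω := by gcongr
      _ = γ * l := by rw [hl]; field_simp
  obtain ⟨f₁, f₁', f₂, f₂', h₁, h₁', h₂, h₂', hb⟩ := exists_real_decaying_solution (ξ := ξ) hμ0 hγ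
    hC0 hl0 hl' hV1.continuousOn hV2.continuousOn hV
  have hsol := solvesGEP_ofReal hμ2 h₁ h₁' h₂ h₂'
  have hbc : ∀ x : ℝ, 0 < x →
      ‖(exp (μ * x) : ℂ) * (f₁ x : ℂ)‖ ≤ 4 * C0 * exp l / γ * μ⁻¹ * exp (-γ * x) ∧
      ‖(exp (μ * x) : ℂ) * (f₂ x : ℂ) - 1‖ ≤ 4 * C0 * exp l / γ * μ⁻¹ * exp (-γ * x) := by
    intro x hx
    rw [← Complex.ofReal_mul, ← Complex.ofReal_mul, ← Complex.ofReal_one, ← Complex.ofReal_sub,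
      Complex.norm_real, Complex.norm_real]
    exact hb x hx
  refine ⟨fun x => f₁ x, fun x => f₂ x, hsol, hbc, fun g1 g2 hg ⟨C', hC', hgb⟩ x hx => ?_⟩
  refine hsol.eq_of_norm_sub_le hg hω hμ0 hμ2 hγ hC0.le
    (B := C' * μ⁻¹ + 4 * C0 * exp l / γ * μ⁻¹) (by positivity) hV (fun x hx => ?_)
    (fun x hx => norm_sub_le_of_exp_mul (hgb x hx).2 (hbc x hx).2) hx
  exact norm_sub_le_of_exp_mul (e := 0) (by simpa only [sub_zero] using (hgb x hx).1)
    (by simpa only [sub_zero] using (hbc x hx).1)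
end

section
/- Let $\xi\in\mathbb{R}$, $\omega>0$, $\mu=\sqrt{\xi^2+4\omega}$, $\gamma>0$, $C_0>0$, and let $V_1,V_2:\mathbb{R}\to\mathbb{R}$ be smooth with $|V_1(x)|+|V_2(x)|\le C_0 e^{-\gamma|x|}$ for all $x$. Then there exist $x_1\in\mathbb{R}$, a solution $\tilde f_4=(\tilde f_4^{(1)},\tilde f_4^{(2)})$ of the generalized eigenvalue system on $(x_1,\infty)$, and a constant $C$ (depending only on $C_0$, $\gamma$, $\omega$) such that $|\tilde f_4(x)|\le 2e^{\mu x}$ for all $x\ge x_1$ and, for $j=1,2$ and all $x\ge x_1$, $\big|e^{-\mu x}\tilde f_4^{(j)}(x)-\delta_{2j}\big|\le C\,\mu^{-(3-j)}\,\langle x\rangle^{2}\,e^{-x\min(\gamma,\mu)}$, where $\delta_{2j}$ is the Kronecker delta. -/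
open Real Set

section

open MeasureTheory

/-- A fundamental pair for `y'' = -ξ² y`, uniformly including the degenerate case `ξ = 0`. -/
theorem exists_fundamental_pair (ξ : ℝ) : ∃ S c : ℝ → ℝ, S 0 = 0 ∧
    (∀ x, HasDerivAt S (c x) x) ∧ (∀ x, HasDerivAt c (-ξ ^ 2 * S x) x) ∧
    (∀ x y, S (x - y) = S x * c y - c x * S y) ∧
    (∀ x, c x ^ 2 + ξ ^ 2 * S x ^ 2 = 1) ∧ ∀ s, |S s| ≤ |s| := by
  rcases eq_or_ne ξ 0 with rfl | hξ
  · refine ⟨fun x => x, fun _ => 1, rfl, fun x => hasDerivAt_id x, fun x => ?_, ?_, ?_, ?_⟩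
    · simpa using hasDerivAt_const x (1 : ℝ)
    · intros; ring
    · intros; ring
    · intros; rfl
  · refine ⟨fun x => sin (ξ * x) / ξ, fun x => cos (ξ * x), by simp, fun x => ?_, fun x => ?_,
      fun x y => ?_, fun x => ?_, fun s => ?_⟩
    · have h := (((hasDerivAt_id x).const_mul ξ).sin).div_const ξ
      simpa [hξ] using h
    · have h : HasDerivAt (fun x => cos (ξ * x)) (-sin (ξ * x) * (ξ * 1)) x :=
        ((hasDerivAt_id x).const_mul ξ).cos
      exact h.congr_deriv (by field_simp)
    · simp only [mul_sub, sin_sub]; field_simp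
    · have := sin_sq_add_cos_sq (ξ * x)
      field_simp
      linarith
    · have h := Real.abs_sin_le_abs (x := ξ * s)
      rw [abs_div, div_le_iff₀ (abs_pos.2 hξ)]
      rwa [abs_mul ξ, mul_comm |ξ|] at h

theorem abs_coupling_le {a b p q B : ℝ} (hp : |p| ≤ B) (hq : |q| ≤ B) :
    |2 * a * p + 2 * b * q| ≤ 2 * B * (|a| + |b|) := by
  have h1 : |2 * a * p| ≤ 2 * B * |a| := by
    rw [abs_mul, abs_mul, abs_two]
    nlinarith [mul_le_mul_of_nonneg_left hp (abs_nonneg a)]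
  have h2 : |2 * b * q| ≤ 2 * B * |b| := by
    rw [abs_mul, abs_mul, abs_two]
    nlinarith [mul_le_mul_of_nonneg_left hq (abs_nonneg b)]
  linarith [abs_add_le (2 * a * p) (2 * b * q)]

section Coupling

variable {V W K p q : ℝ → ℝ} {κ a B : ℝ}

theorem abs_kernel_mul_coupling_le (hKb : ∀ s, |K s| ≤ κ) (hpb : ∀ y, |p y| ≤ B)
    (hqb : ∀ y, |q y| ≤ B) (x y : ℝ) :
    ‖K (x - y) * (2 * V y * p y + 2 * W y * q y)‖ ≤ κ * (2 * B) * (|V y| + |W y|) := by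
  rw [norm_mul, mul_assoc κ]
  exact mul_le_mul (hKb _) (abs_coupling_le (hpb y) (hqb y)) (norm_nonneg _)
    ((abs_nonneg _).trans (hKb 0))

theorem integrableOn_kernel_mul_coupling (hV : Continuous V) (hW : Continuous W)
    (hK : Continuous K) (hKb : ∀ s, |K s| ≤ κ)
    (h_int : IntegrableOn (fun y => |V y| + |W y|) (Ioi a)) (hp : Continuous p)
    (hq : Continuous q) (hpb : ∀ y, |p y| ≤ B) (hqb : ∀ y, |q y| ≤ B) (x : ℝ) :
    IntegrableOn (fun y => K (x - y) * (2 * V y * p y + 2 * W y * q y)) (Ioi a) := by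
  refine Integrable.mono' (h_int.const_mul (κ * (2 * B))) ?_ ?_
  · exact Continuous.aestronglyMeasurable (by fun_prop)
  · exact Filter.Eventually.of_forall (abs_kernel_mul_coupling_le hKb hpb hqb x)

theorem continuous_integral_kernel_mul_coupling (hV : Continuous V) (hW : Continuous W)
    (hK : Continuous K) (hKb : ∀ s, |K s| ≤ κ)
    (h_int : IntegrableOn (fun y => |V y| + |W y|) (Ioi a)) (hp : Continuous p)
    (hq : Continuous q) (hpb : ∀ y, |p y| ≤ B) (hqb : ∀ y, |q y| ≤ B) :
    Continuous fun x => ∫ y in Ioi a, K (x - y) * (2 * V y * p y + 2 * W y * q y) := by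
  refine continuous_of_dominated (bound := fun y => κ * (2 * B) * (|V y| + |W y|))
    (fun x => ?_) (fun x => ?_) (h_int.const_mul _) ?_
  · exact Continuous.aestronglyMeasurable (by fun_prop)
  · exact Filter.Eventually.of_forall (abs_kernel_mul_coupling_le hKb hpb hqb x)
  · exact Filter.Eventually.of_forall fun y => by fun_prop

theorem abs_integral_kernel_mul_coupling_le (hKb : ∀ s, |K s| ≤ κ)
    (h_int : IntegrableOn (fun y => |V y| + |W y|) (Ioi a))
    (hpb : ∀ y, |p y| ≤ B) (hqb : ∀ y, |q y| ≤ B) (x : ℝ) :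
    |∫ y in Ioi a, K (x - y) * (2 * V y * p y + 2 * W y * q y)| ≤
      κ * (2 * ∫ y in Ioi a, (|V y| + |W y|)) * B := by
  refine (norm_integral_le_of_norm_le (h_int.const_mul (κ * (2 * B)))
    (Filter.Eventually.of_forall (abs_kernel_mul_coupling_le hKb hpb hqb x))).trans_eq ?_
  rw [integral_const_mul]
  ring

end Coupling

/-- Solvability of a coupled linear system of integral equations with a small kernel. -/
theorem exists_solution_integral_system {V W K₁ K₂ : ℝ → ℝ} {κ a : ℝ} (hV : Continuous V)
    (hW : Continuous W) (hK₁ : Continuous K₁) (hK₂ : Continuous K₂) (hK₁b : ∀ s, |K₁ s| ≤ κ)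
    (hK₂b : ∀ s, |K₂ s| ≤ κ) (h_int : IntegrableOn (fun y => |V y| + |W y|) (Ioi a))
    (hsmall : κ * (2 * ∫ y in Ioi a, (|V y| + |W y|)) ≤ 1 / 2) :
    ∃ u v : ℝ → ℝ, Continuous u ∧ Continuous v ∧ (∀ x, |u x| ≤ 2) ∧ (∀ x, |v x| ≤ 2) ∧
      (∀ x, u x = ∫ y in Ioi a, K₁ (x - y) * (2 * V y * u y + 2 * W y * v y)) ∧
      (∀ x, v x = 1 + ∫ y in Ioi a, K₂ (x - y) * (2 * V y * v y + 2 * W y * u y)) := by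
  let I : (ℝ → ℝ) → (ℝ → ℝ) → (ℝ → ℝ) → ℝ → ℝ := fun K p q x =>
    ∫ y in Ioi a, K (x - y) * (2 * V y * p y + 2 * W y * q y)
  have hIb : ∀ K : ℝ → ℝ, (∀ s, |K s| ≤ κ) → ∀ p q : ℝ → ℝ, ∀ B, (∀ y, |p y| ≤ B) →
      (∀ y, |q y| ≤ B) → ∀ x, |I K p q x| ≤ 1 / 2 * B := fun K hK p q B hp hq x =>
    (abs_integral_kernel_mul_coupling_le hK h_int hp hq x).trans
      (mul_le_mul_of_nonneg_right hsmall ((abs_nonneg _).trans (hp 0)))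
  have h1 : ∀ (F : BoundedContinuousFunction ℝ (ℝ × ℝ)) y, |(F y).1| ≤ ‖F‖ := fun F y =>
    (norm_fst_le (F y)).trans (F.norm_coe_le_norm y)
  have h2 : ∀ (F : BoundedContinuousFunction ℝ (ℝ × ℝ)) y, |(F y).2| ≤ ‖F‖ := fun F y =>
    (norm_snd_le (F y)).trans (F.norm_coe_le_norm y)
  have hcont : ∀ F : BoundedContinuousFunction ℝ (ℝ × ℝ), Continuous fun x =>
      (I K₁ (fun y => (F y).1) (fun y => (F y).2) x,
        1 + I K₂ (fun y => (F y).2) (fun y => (F y).1) x) := fun F =>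
    (continuous_integral_kernel_mul_coupling hV hW hK₁ hK₁b h_int (by fun_prop) (by fun_prop)
      (h1 F) (h2 F)).prodMk (continuous_const.add
        (continuous_integral_kernel_mul_coupling hV hW hK₂ hK₂b h_int (by fun_prop) (by fun_prop)
          (h2 F) (h1 F)))
  have hbd : ∀ (F : BoundedContinuousFunction ℝ (ℝ × ℝ)) x,
      ‖(I K₁ (fun y => (F y).1) (fun y => (F y).2) x,
        1 + I K₂ (fun y => (F y).2) (fun y => (F y).1) x)‖ ≤ 1 + 1 / 2 * ‖F‖ := fun F x => by
    have e1 := hIb K₁ hK₁b _ _ _ (h1 F) (h2 F) x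
    have e2 := hIb K₂ hK₂b _ _ _ (h2 F) (h1 F) x
    refine max_le (e1.trans (by linarith)) ((norm_add_le _ _).trans ?_)
    rw [norm_one]
    exact add_le_add_right e2 1
  let T : BoundedContinuousFunction ℝ (ℝ × ℝ) → BoundedContinuousFunction ℝ (ℝ × ℝ) := fun F =>
    BoundedContinuousFunction.ofNormedAddCommGroup _ (hcont F) _ (hbd F)
  have hIsub : ∀ K : ℝ → ℝ, Continuous K → (∀ s, |K s| ≤ κ) →
      ∀ p q p' q' : ℝ → ℝ, Continuous p → Continuous q → Continuous p' → Continuous q' →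
      ∀ B, (∀ y, |p y| ≤ B) → (∀ y, |q y| ≤ B) → ∀ B', (∀ y, |p' y| ≤ B') → (∀ y, |q' y| ≤ B') →
      ∀ x, I K p q x - I K p' q' x = I K (fun y => p y - p' y) (fun y => q y - q' y) x := by
    intro K hK hKb p q p' q' hp hq hp' hq' B hpb hqb B' hpb' hqb' x
    simp only [I]
    rw [← integral_sub
      (integrableOn_kernel_mul_coupling hV hW hK hKb h_int hp hq hpb hqb x)
      (integrableOn_kernel_mul_coupling hV hW hK hKb h_int hp' hq' hpb' hqb' x)]
    congr 1 with y
    ring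
  have hT : ContractingWith (1 / 2) T := by
    refine ⟨by norm_num, LipschitzWith.of_dist_le_mul fun F G => ?_⟩
    rw [BoundedContinuousFunction.dist_le (by positivity)]
    intro x
    have d1 : ∀ y, |(F y).1 - (G y).1| ≤ dist F G := fun y => by
      rw [dist_eq_norm]; exact h1 (F - G) y
    have d2 : ∀ y, |(F y).2 - (G y).2| ≤ dist F G := fun y => by
      rw [dist_eq_norm]; exact h2 (F - G) y
    have e1 := hIb K₁ hK₁b _ _ _ d1 d2 x
    have e2 := hIb K₂ hK₂b _ _ _ d2 d1 x
    rw [← hIsub K₁ hK₁ hK₁b _ _ _ _ (by fun_prop) (by fun_prop) (by fun_prop) (by fun_prop)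
      _ (h1 F) (h2 F) _ (h1 G) (h2 G)] at e1
    rw [← hIsub K₂ hK₂ hK₂b _ _ _ _ (by fun_prop) (by fun_prop) (by fun_prop) (by fun_prop)
      _ (h2 F) (h1 F) _ (h2 G) (h1 G)] at e2
    rw [Prod.dist_eq]
    refine max_le (by simpa [T, Real.dist_eq] using e1) (by simpa [T, Real.dist_eq] using e2)
  set F := ContractingWith.fixedPoint T hT
  have hF : T F = F := hT.fixedPoint_isFixedPt
  have hFx : ∀ x, F x = (I K₁ (fun y => (F y).1) (fun y => (F y).2) x,
        1 + I K₂ (fun y => (F y).2) (fun y => (F y).1) x) := fun x =>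
    (DFunLike.congr_fun hF x).symm
  have hnorm : ‖F‖ ≤ 2 := by
    have : ‖F‖ ≤ 1 + 1 / 2 * ‖F‖ :=
      (BoundedContinuousFunction.norm_le (by positivity)).2 fun x => by
        rw [hFx x]; exact hbd F x
    linarith
  exact ⟨fun y => (F y).1, fun y => (F y).2, by fun_prop, by fun_prop,
    fun x => (h1 F x).trans hnorm, fun x => (h2 F x).trans hnorm,
    fun x => congrArg Prod.fst (hFx x), fun x => congrArg Prod.snd (hFx x)⟩

theorem exp_neg_mul_sub_mul_exp_le {κ μ γ x y : ℝ} (hκ : μ ≤ κ) (hy : 0 ≤ y) (hyx : y ≤ x) :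
    exp (-κ * (x - y)) * exp (-γ * y) ≤ exp (-x * min γ μ) := by
  rw [← exp_add, exp_le_exp]
  have h1 := mul_le_mul_of_nonneg_right ((min_le_right γ μ).trans hκ) (sub_nonneg.2 hyx)
  have h2 := mul_le_mul_of_nonneg_right (min_le_left γ μ) hy
  nlinarith

theorem integral_exp_neg_mul_sub_le {κ : ℝ} (hκ : 0 < κ) (a x : ℝ) :
    ∫ y in a..x, exp (-κ * (x - y)) ≤ 1 / κ := by
  have hd : ∀ y ∈ uIcc a x, HasDerivAt (fun y => exp (-κ * (x - y)) / κ)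
      (exp (-κ * (x - y))) y := fun y _ => by
    have h : HasDerivAt (fun y => exp (-κ * (x - y)) / κ)
        (exp (-κ * (x - y)) * (-κ * -1) / κ) y :=
      ((((hasDerivAt_id y).const_sub x).const_mul (-κ)).exp).div_const κ
    exact h.congr_deriv (by field_simp)
  rw [intervalIntegral.integral_eq_sub_of_hasDerivAt hd
    (Continuous.intervalIntegrable (by fun_prop) _ _)]
  rw [sub_self, mul_zero, exp_zero]
  linarith [div_pos (exp_pos (-κ * (x - a))) hκ]

/-- Bound for the forward integral with linearly growing, exponentially damped kernel. -/
theorem abs_integral_oscillatory_le {S h : ℝ → ℝ} {μ γ D a x : ℝ} (hμ : 0 < μ) (hγ : 0 < γ)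
    (hD : 0 ≤ D) (ha : 0 ≤ a) (hax : a ≤ x) (hS : ∀ s, |S s| ≤ |s|)
    (hh : ∀ y, 0 ≤ y → |h y| ≤ D * exp (-γ * y)) :
    |∫ y in a..x, exp (-μ * (x - y)) * S (x - y) * h y| ≤
      D * (16 + 4 * γ ^ 2) / μ ^ 2 * (1 + x ^ 2) * exp (-x * min γ μ) := by
  have hx : 0 ≤ x := ha.trans hax
  have hpt : ∀ y ∈ Ioc a x, ‖exp (-μ * (x - y)) * S (x - y) * h y‖ ≤
      D * ((x - y) * (exp (-μ * (x - y)) * exp (-γ * y))) := fun y hy => by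
    have hs : |S (x - y)| ≤ x - y := (hS _).trans_eq (abs_of_nonneg (sub_nonneg.2 hy.2))
    rw [norm_mul, norm_mul, norm_eq_abs, norm_eq_abs, norm_eq_abs, abs_exp]
    calc _ ≤ exp (-μ * (x - y)) * (x - y) * (D * exp (-γ * y)) :=
          mul_le_mul (mul_le_mul_of_nonneg_left hs (exp_pos _).le) (hh y (ha.trans hy.1.le))
            (abs_nonneg _) (mul_nonneg (exp_pos _).le (sub_nonneg.2 hy.2))
      _ = _ := by ring
  rcases le_total μ (2 * γ) with hc | hc
  · have key : ‖∫ y in a..x, exp (-μ * (x - y)) * S (x - y) * h y‖ ≤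
        D * (x * exp (-x * min γ μ)) * |x - a| := by
      refine intervalIntegral.norm_integral_le_of_norm_le_const fun y hy => ?_
      rw [uIoc_of_le hax] at hy
      have hy0 : 0 ≤ y := ha.trans hy.1.le
      refine (hpt y hy).trans (mul_le_mul_of_nonneg_left ?_ hD)
      exact mul_le_mul (by linarith) (exp_neg_mul_sub_mul_exp_le le_rfl hy0 hy.2)
        (by positivity) hx
    refine key.trans ?_
    rw [abs_of_nonneg (sub_nonneg.2 hax)]
    have h1 : 1 ≤ (16 + 4 * γ ^ 2) / μ ^ 2 := by
      rw [one_le_div (by positivity)]; nlinarith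
    have hE := exp_pos (-x * min γ μ)
    calc D * (x * exp (-x * min γ μ)) * (x - a) ≤ D * (x * exp (-x * min γ μ)) * x := by
          gcongr; linarith
      _ = D * 1 * x ^ 2 * exp (-x * min γ μ) := by ring
      _ ≤ D * ((16 + 4 * γ ^ 2) / μ ^ 2) * (1 + x ^ 2) * exp (-x * min γ μ) := by
          gcongr; linarith
      _ = _ := by ring
  · have hm : min γ μ = γ := min_eq_left (by linarith)
    rw [hm]
    have key : ‖∫ y in a..x, exp (-μ * (x - y)) * S (x - y) * h y‖ ≤
        ∫ y in a..x, D * (4 / μ) * exp (-γ * x) * exp (-(μ / 4) * (x - y)) := by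
      refine intervalIntegral.norm_integral_le_of_norm_le hax
        (Filter.Eventually.of_forall fun y hy => (hpt y hy).trans ?_)
        (Continuous.intervalIntegrable (by fun_prop) _ _)
      have hs : 0 ≤ x - y := sub_nonneg.2 hy.2
      have h1 : x - y ≤ 4 / μ * exp (μ / 4 * (x - y)) := by
        have := add_one_le_exp (μ / 4 * (x - y))
        calc x - y = 4 / μ * (μ / 4 * (x - y)) := by field_simp
          _ ≤ _ := by gcongr; linarith
      have h2 : exp (-μ * (x - y)) * exp (-γ * y) ≤
          exp (-γ * x) * exp (-(μ / 2) * (x - y)) := by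
        rw [← exp_add, ← exp_add, exp_le_exp]
        nlinarith [mul_le_mul_of_nonneg_right hc hs]
      calc D * ((x - y) * (exp (-μ * (x - y)) * exp (-γ * y)))
          ≤ D * ((4 / μ * exp (μ / 4 * (x - y))) *
            (exp (-γ * x) * exp (-(μ / 2) * (x - y)))) := by gcongr
        _ = D * (4 / μ) * exp (-γ * x) *
            (exp (μ / 4 * (x - y)) * exp (-(μ / 2) * (x - y))) := by ring
        _ = _ := by rw [← exp_add]; ring_nf
    refine key.trans ?_
    rw [intervalIntegral.integral_const_mul]
    calc _ ≤ D * (4 / μ) * exp (-γ * x) * (1 / (μ / 4)) := by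
          gcongr
          exact integral_exp_neg_mul_sub_le (by positivity) a x
      _ = D * 16 / μ ^ 2 * 1 * exp (-x * γ) := by
          rw [show -γ * x = -x * γ by ring]; field_simp; norm_num
      _ ≤ _ := by
          gcongr
          · nlinarith [sq_nonneg γ]
          · nlinarith [sq_nonneg x]

/-- Bound for the forward-backward integral with exponentially damped forward kernel. -/
theorem abs_integral_exponential_le {h : ℝ → ℝ} {μ γ D a x : ℝ} (hμ : 0 < μ) (hγ : 0 < γ)
    (hD : 0 ≤ D) (ha : 0 ≤ a) (hax : a ≤ x) (hh : ∀ y, 0 ≤ y → |h y| ≤ D * exp (-γ * y)) :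
    |(∫ y in a..x, exp (-(2 * μ) * (x - y)) * h y) + ∫ y in Ioi x, h y| ≤
      D * (1 + 1 / γ) * (1 + x ^ 2) * exp (-x * min γ μ) := by
  have hx : 0 ≤ x := ha.trans hax
  have h1 : ‖∫ y in a..x, exp (-(2 * μ) * (x - y)) * h y‖ ≤
      D * exp (-x * min γ μ) * |x - a| := by
    refine intervalIntegral.norm_integral_le_of_norm_le_const fun y hy => ?_
    rw [uIoc_of_le hax] at hy
    have hy0 : 0 ≤ y := ha.trans hy.1.le
    rw [norm_mul, norm_eq_abs, norm_eq_abs, abs_exp]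
    calc _ ≤ exp (-(2 * μ) * (x - y)) * (D * exp (-γ * y)) := by gcongr; exact hh y hy0
      _ = D * (exp (-(2 * μ) * (x - y)) * exp (-γ * y)) := by ring
      _ ≤ _ := by
        gcongr
        exact exp_neg_mul_sub_mul_exp_le (by linarith) hy0 hy.2
  have h2 : ‖∫ y in Ioi x, h y‖ ≤ ∫ y in Ioi x, D * exp (-γ * y) := by
    refine norm_integral_le_of_norm_le
      ((integrableOn_exp_mul_Ioi (neg_neg_of_pos hγ) x).const_mul D) ?_
    filter_upwards [ae_restrict_mem measurableSet_Ioi] with y hy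
    exact hh y (hx.trans (le_of_lt hy))
  rw [integral_const_mul, integral_exp_mul_Ioi (neg_neg_of_pos hγ), neg_div_neg_eq] at h2
  rw [abs_of_nonneg (sub_nonneg.2 hax)] at h1
  have h3 : exp (-γ * x) ≤ exp (-x * min γ μ) := by
    rw [exp_le_exp]; nlinarith [mul_le_mul_of_nonneg_right (min_le_left γ μ) hx]
  set E := exp (-x * min γ μ)
  have hE : 0 < E := exp_pos _
  refine (abs_add_le _ _).trans ((add_le_add h1 h2).trans ?_)
  calc D * E * (x - a) + D * (exp (-γ * x) / γ) ≤ D * E * (1 + x ^ 2) + D * (E / γ) := by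
        gcongr; nlinarith [sq_nonneg (x - 1)]
    _ = D * E * (1 + x ^ 2) + D * (E / γ) * 1 := by ring
    _ ≤ D * E * (1 + x ^ 2) + D * (E / γ) * (1 + x ^ 2) := by
        gcongr; nlinarith [sq_nonneg x]
    _ = _ := by ring

theorem variation_of_parameters {φ φ' ψ ψ' A B g : ℝ → ℝ} {k : ℝ}
    (hφ : ∀ x, HasDerivAt φ (φ' x) x) (hφ' : ∀ x, HasDerivAt φ' (k * φ x) x)
    (hψ : ∀ x, HasDerivAt ψ (ψ' x) x) (hψ' : ∀ x, HasDerivAt ψ' (k * ψ x) x)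
    (hW : ∀ x, φ' x * ψ x - φ x * ψ' x = 1)
    (hA : ∀ x, HasDerivAt A (ψ x * g x) x) (hB : ∀ x, HasDerivAt B (φ x * g x) x) (x : ℝ) :
    HasDerivAt (fun x => φ x * A x - ψ x * B x) (φ' x * A x - ψ' x * B x) x ∧
    HasDerivAt (fun x => φ' x * A x - ψ' x * B x) (k * (φ x * A x - ψ x * B x) + g x) x := by
  constructor
  · exact (((hφ x).mul (hA x)).sub ((hψ x).mul (hB x))).congr_deriv (by ring)
  · exact (((hφ' x).mul (hA x)).sub ((hψ' x).mul (hB x))).congr_deriv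
      (by linear_combination g x * hW x)

theorem solvesGEP_ofReal_s17 {ξ ω : ℝ} {V1 V2 f f' F F' g G : ℝ → ℝ} {s : Set ℝ}
    (hf : ∀ x, HasDerivAt f (f' x) x) (hf' : ∀ x, HasDerivAt f' (-ξ ^ 2 * f x + g x) x)
    (hF : ∀ x, HasDerivAt F (F' x) x)
    (hF' : ∀ x, HasDerivAt F' ((ξ ^ 2 + 4 * ω) * F x + G x) x)
    (hg : ∀ x ∈ s, g x = 2 * V1 x * f x + 2 * V2 x * F x)
    (hG : ∀ x ∈ s, G x = 2 * V1 x * F x + 2 * V2 x * f x) :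
    SolvesGEP ξ ω V1 V2 (fun x => (f x : ℂ)) (fun x => (F x : ℂ)) s := by
  have d1 : deriv (fun x => (f x : ℂ)) = fun x => (f' x : ℂ) :=
    funext fun x => (hf x).ofReal_comp.deriv
  have d2 : deriv (fun x => (F x : ℂ)) = fun x => (F' x : ℂ) :=
    funext fun x => (hF x).ofReal_comp.deriv
  refine ⟨fun x _ => ⟨(hf x).ofReal_comp.differentiableAt, ?_,
    (hF x).ofReal_comp.differentiableAt, ?_⟩, fun x hx => ?_⟩
  · rw [d1]; exact (hf' x).ofReal_comp.differentiableAt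
  · rw [d2]; exact (hF' x).ofReal_comp.differentiableAt
  · rw [d1, d2, (hf' x).ofReal_comp.deriv, (hF' x).ofReal_comp.deriv, hg x hx, hG x hx]
    push_cast
    constructor <;> ring

/-- The real growing Jost-type solution, with explicit bounds for its deviation from `e^{μx}(0,1)`. -/
theorem exists_growing_jost_solution {ξ ω μ γ C0 : ℝ} {V1 V2 : ℝ → ℝ} (hμ : 0 < μ)
    (hμξ : μ ^ 2 = ξ ^ 2 + 4 * ω) (hγ : 0 < γ) (hC0 : 0 < C0) (hV1 : Continuous V1)
    (hV2 : Continuous V2) (hV : ∀ x, |V1 x| + |V2 x| ≤ C0 * exp (-γ * |x|)) :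
    ∃ (a : ℝ) (u v : ℝ → ℝ) (f f' F F' g G : ℝ → ℝ),
      (∀ x, HasDerivAt f (f' x) x) ∧ (∀ x, HasDerivAt f' (-ξ ^ 2 * f x + g x) x) ∧
      (∀ x, HasDerivAt F (F' x) x) ∧ (∀ x, HasDerivAt F' ((ξ ^ 2 + 4 * ω) * F x + G x) x) ∧
      (∀ x, a ≤ x → g x = 2 * V1 x * f x + 2 * V2 x * F x) ∧
      (∀ x, a ≤ x → G x = 2 * V1 x * F x + 2 * V2 x * f x) ∧
      (∀ x, a ≤ x → f x = exp (μ * x) * u x) ∧ (∀ x, a ≤ x → F x = exp (μ * x) * v x) ∧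
      (∀ x, |u x| ≤ 2) ∧ (∀ x, |v x| ≤ 2) ∧
      (∀ x, a ≤ x → |u x| ≤
        4 * C0 * (16 + 4 * γ ^ 2) / μ ^ 2 * (1 + x ^ 2) * exp (-x * min γ μ)) ∧
      (∀ x, a ≤ x → |v x - 1| ≤
        2 * C0 * (1 + 1 / γ) / μ * (1 + x ^ 2) * exp (-x * min γ μ)) := by
  obtain ⟨S, c, hS0, hS, hc, hSsub, hSc, hSb⟩ := exists_fundamental_pair ξ
  have hScont : Continuous S := continuous_iff_continuousAt.2 fun x => (hS x).continuousAt
  have hccont : Continuous c := continuous_iff_continuousAt.2 fun x => (hc x).continuousAt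
  obtain ⟨a, ha0, ha⟩ : ∃ a : ℝ, 0 ≤ a ∧ exp (-γ * a) ≤ γ * μ / (4 * C0) := by
    have ht : Filter.Tendsto (fun a : ℝ => exp (-γ * a)) Filter.atTop (nhds 0) :=
      tendsto_exp_atBot.comp (Filter.tendsto_id.const_mul_atTop_of_neg (neg_neg_of_pos hγ))
    exact ((Filter.eventually_ge_atTop 0).and
      (ht.eventually_le_const (by positivity : 0 < γ * μ / (4 * C0)))).exists
  have hVpos : ∀ y, 0 ≤ y → |V1 y| + |V2 y| ≤ C0 * exp (-γ * y) := fun y hy => by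
    simpa [abs_of_nonneg hy] using hV y
  have hexpint : IntegrableOn (fun y => C0 * exp (-γ * y)) (Ioi a) :=
    (integrableOn_exp_mul_Ioi (neg_neg_of_pos hγ) a).const_mul C0
  have hVint : IntegrableOn (fun y => |V1 y| + |V2 y|) (Ioi a) := by
    refine Integrable.mono' hexpint (Continuous.aestronglyMeasurable (by fun_prop)) ?_
    filter_upwards [ae_restrict_mem measurableSet_Ioi] with y hy
    rw [norm_of_nonneg (by positivity)]
    exact hVpos y (ha0.trans (le_of_lt hy))
  have hsmall : 1 / μ * (2 * ∫ y in Ioi a, (|V1 y| + |V2 y|)) ≤ 1 / 2 := by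
    have h1 : ∫ y in Ioi a, (|V1 y| + |V2 y|) ≤ ∫ y in Ioi a, C0 * exp (-γ * y) :=
      setIntegral_mono_on hVint hexpint measurableSet_Ioi
        fun y hy => hVpos y (ha0.trans (le_of_lt hy))
    rw [integral_const_mul, integral_exp_mul_Ioi (neg_neg_of_pos hγ), neg_div_neg_eq] at h1
    calc _ ≤ 1 / μ * (2 * (C0 * ((γ * μ / (4 * C0)) / γ))) := by
          gcongr
          exact h1.trans (by gcongr)
      _ = 1 / 2 := by field_simp; norm_num
  let K₁ : ℝ → ℝ := fun s => exp (-μ * max s 0) * S (max s 0)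
  let K₂ : ℝ → ℝ := fun s => -(1 / (2 * μ)) * exp (-(2 * μ) * max s 0)
  have hK₁c : Continuous K₁ := by fun_prop
  have hK₂c : Continuous K₂ := by fun_prop
  have hK₁b : ∀ s, |K₁ s| ≤ 1 / μ := fun s => by
    have hs : 0 ≤ max s 0 := le_max_right s 0
    have h1 : max s 0 ≤ 1 / μ * exp (μ * max s 0) := by
      have := add_one_le_exp (μ * max s 0)
      calc max s 0 = 1 / μ * (μ * max s 0) := by field_simp
        _ ≤ _ := by gcongr; linarith
    rw [abs_mul, abs_exp]
    calc _ ≤ exp (-μ * max s 0) * (1 / μ * exp (μ * max s 0)) := by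
          gcongr
          exact ((hSb _).trans_eq (abs_of_nonneg hs)).trans h1
      _ = 1 / μ * exp (-μ * max s 0 + μ * max s 0) := by rw [exp_add]; ring
      _ = 1 / μ := by rw [neg_mul, neg_add_cancel, exp_zero, mul_one]
  have hK₂b : ∀ s, |K₂ s| ≤ 1 / μ := fun s => by
    have hs : 0 ≤ max s 0 := le_max_right s 0
    have h1 : exp (-(2 * μ) * max s 0) ≤ 1 := exp_le_one_iff.2 (by nlinarith)
    rw [abs_mul, abs_exp, abs_neg, abs_of_pos (by positivity)]
    calc _ ≤ 1 / (2 * μ) * 1 := by gcongr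
      _ ≤ 1 / μ := by rw [mul_one]; gcongr; linarith
  obtain ⟨u, v, huc, hvc, hu2, hv2, hu, hv⟩ := exists_solution_integral_system hV1 hV2 hK₁c hK₂c
    hK₁b hK₂b hVint hsmall
  let h₁ : ℝ → ℝ := fun y => 2 * V1 y * u y + 2 * V2 y * v y
  let h₂ : ℝ → ℝ := fun y => 2 * V1 y * v y + 2 * V2 y * u y
  have hh₁c : Continuous h₁ := by fun_prop
  have hh₂c : Continuous h₂ := by fun_prop
  have hh₁ : ∀ y, 0 ≤ y → |h₁ y| ≤ 4 * C0 * exp (-γ * y) := fun y hy =>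
    (abs_coupling_le (hu2 y) (hv2 y)).trans (by linarith [hVpos y hy])
  have hh₂ : ∀ y, 0 ≤ y → |h₂ y| ≤ 4 * C0 * exp (-γ * y) := fun y hy =>
    (abs_coupling_le (hv2 y) (hu2 y)).trans (by linarith [hVpos y hy])
  have h_int₂ : IntegrableOn h₂ (Ioi a) := by
    refine Integrable.mono' (hexpint.const_mul 4) hh₂c.aestronglyMeasurable ?_
    filter_upwards [ae_restrict_mem measurableSet_Ioi] with y hy
    exact (hh₂ y (ha0.trans (le_of_lt hy))).trans_eq (by ring)
  have hu' : ∀ x, a ≤ x → u x = ∫ y in a..x, exp (-μ * (x - y)) * S (x - y) * h₁ y := by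
    intro x hx
    have hi := integrableOn_kernel_mul_coupling hV1 hV2 hK₁c hK₁b hVint huc hvc hu2 hv2 x
    have hz : ∫ y in Ioi x, K₁ (x - y) * (2 * V1 y * u y + 2 * V2 y * v y) = 0 :=
      setIntegral_eq_zero_of_forall_eq_zero fun y hy => by
        have : max (x - y) 0 = 0 := max_eq_right (sub_nonpos.2 (le_of_lt hy))
        simp [K₁, this, hS0]
    rw [hu x, ← intervalIntegral.integral_interval_add_Ioi hi (hi.mono_set (Ioi_subset_Ioi hx)),
      hz, add_zero]
    refine intervalIntegral.integral_congr fun y hy => ?_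
    rw [uIcc_of_le hx] at hy
    have : max (x - y) 0 = x - y := max_eq_left (sub_nonneg.2 hy.2)
    simp [K₁, this, h₁]
  have hv' : ∀ x, a ≤ x → v x = 1 + -(1 / (2 * μ)) *
      ((∫ y in a..x, exp (-(2 * μ) * (x - y)) * h₂ y) + ∫ y in Ioi x, h₂ y) := by
    intro x hx
    have hi := integrableOn_kernel_mul_coupling hV1 hV2 hK₂c hK₂b hVint hvc huc hv2 hu2 x
    have hz : ∫ y in Ioi x, K₂ (x - y) * (2 * V1 y * v y + 2 * V2 y * u y) =
        ∫ y in Ioi x, -(1 / (2 * μ)) * h₂ y :=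
      setIntegral_congr_fun measurableSet_Ioi fun y hy => by
        have : max (x - y) 0 = 0 := max_eq_right (sub_nonpos.2 (le_of_lt hy))
        simp [K₂, this, h₂]
    have hw : ∫ y in a..x, K₂ (x - y) * (2 * V1 y * v y + 2 * V2 y * u y) =
        ∫ y in a..x, -(1 / (2 * μ)) * (exp (-(2 * μ) * (x - y)) * h₂ y) := by
      refine intervalIntegral.integral_congr fun y hy => ?_
      rw [uIcc_of_le hx] at hy
      have : max (x - y) 0 = x - y := max_eq_left (sub_nonneg.2 hy.2)
      simp only [K₂, this, h₂]
      ring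
    rw [hv x, ← intervalIntegral.integral_interval_add_Ioi hi (hi.mono_set (Ioi_subset_Ioi hx)),
      hz, hw, intervalIntegral.integral_const_mul, integral_const_mul, mul_add]
  let g : ℝ → ℝ := fun y => exp (μ * y) * h₁ y
  let G : ℝ → ℝ := fun y => exp (μ * y) * h₂ y
  have hgc : Continuous g := by fun_prop
  have hGc : Continuous G := by fun_prop
  let f : ℝ → ℝ := fun x => S x * (∫ y in a..x, c y * g y) - c x * ∫ y in a..x, S y * g y
  let F : ℝ → ℝ := fun x =>
    exp (μ * x) * (1 - 1 / (2 * μ) * (∫ y in Ioi a, h₂ y) +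
      ∫ y in a..x, 1 / (2 * μ) * exp (-μ * y) * G y) -
    1 / (2 * μ) * exp (-μ * x) * ∫ y in a..x, exp (μ * y) * G y
  have hderiv_integral : ∀ q : ℝ → ℝ, Continuous q → ∀ x,
      HasDerivAt (fun x => ∫ y in a..x, q y) (q x) x := fun q hq x =>
    (hq.integral_hasStrictDerivAt a x).hasDerivAt
  have hexp : ∀ k x : ℝ, HasDerivAt (fun x => exp (k * x)) (k * exp (k * x)) x := fun k x => by
    have h := ((hasDerivAt_id x).const_mul k).exp
    exact h.congr_deriv (by simp [mul_comm])
  have hfode := variation_of_parameters (k := -ξ ^ 2) hS hc hc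
    (fun x => (hS x).const_mul (-ξ ^ 2)) (fun x => by linear_combination hSc x)
    (hderiv_integral (fun y => c y * g y) (by fun_prop))
    (hderiv_integral (fun y => S y * g y) (by fun_prop))
  have hFode := variation_of_parameters (k := ξ ^ 2 + 4 * ω) (g := G) (hexp μ)
    (fun x => ((hexp μ x).const_mul μ).congr_deriv (by rw [← hμξ]; ring))
    (fun x => (hexp (-μ) x).const_mul (1 / (2 * μ)))
    (fun x => (((hexp (-μ) x).const_mul (-μ)).const_mul (1 / (2 * μ))).congr_deriv
      (by rw [← hμξ]; ring))
    (fun x => by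
      have : exp (μ * x) * exp (-μ * x) = 1 := by
        rw [← exp_add, neg_mul, add_neg_cancel, exp_zero]
      have hc : μ * (1 / (2 * μ)) = 1 / 2 := by field_simp
      linear_combination this + 2 * exp (μ * x) * exp (-μ * x) * hc)
    (fun x => (hderiv_integral (fun y => 1 / (2 * μ) * exp (-μ * y) * G y) (by fun_prop) x).const_add
      (1 - 1 / (2 * μ) * (∫ y in Ioi a, h₂ y)))
    (hderiv_integral (fun y => exp (μ * y) * G y) (by fun_prop))
  have hf : ∀ x, a ≤ x → f x = exp (μ * x) * u x := by
    intro x hx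
    rw [hu' x hx, ← intervalIntegral.integral_const_mul]
    simp only [f]
    rw [← intervalIntegral.integral_const_mul, ← intervalIntegral.integral_const_mul,
      ← intervalIntegral.integral_sub (Continuous.intervalIntegrable (by fun_prop) _ _)
        (Continuous.intervalIntegrable (by fun_prop) _ _)]
    congr 1 with y
    rw [hSsub]
    have : exp (μ * x) * exp (-μ * (x - y)) = exp (μ * y) := by
      rw [← exp_add]; ring_nf
    simp only [g]
    rw [← this]
    ring
  have hF : ∀ x, a ≤ x → F x = exp (μ * x) * v x := by
    intro x hx
    have h1 : ∫ y in a..x, 1 / (2 * μ) * exp (-μ * y) * G y =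
        1 / (2 * μ) * ∫ y in a..x, h₂ y := by
      rw [← intervalIntegral.integral_const_mul]
      congr 1 with y
      have : exp (-μ * y) * exp (μ * y) = 1 := by
        rw [← exp_add, neg_mul, neg_add_cancel, exp_zero]
      simp only [G]
      linear_combination 1 / (2 * μ) * h₂ y * this
    have h2 : exp (-μ * x) * ∫ y in a..x, exp (μ * y) * G y =
        exp (μ * x) * ∫ y in a..x, exp (-(2 * μ) * (x - y)) * h₂ y := by
      rw [← intervalIntegral.integral_const_mul, ← intervalIntegral.integral_const_mul]
      congr 1 with y
      simp only [G]
      rw [← mul_assoc, ← mul_assoc, ← mul_assoc, ← exp_add, ← exp_add, ← exp_add]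
      ring_nf
    have h3 := intervalIntegral.integral_interval_add_Ioi h_int₂
      (h_int₂.mono_set (Ioi_subset_Ioi hx))
    rw [hv' x hx]
    simp only [F]
    rw [h1, mul_assoc (1 / (2 * μ)) (exp (-μ * x)), h2, ← h3]
    ring
  refine ⟨a, u, v, f, _, F, _, g, G, fun x => (hfode x).1, fun x => (hfode x).2,
    fun x => (hFode x).1, fun x => (hFode x).2, fun x hx => ?_, fun x hx => ?_, hf, hF, hu2, hv2,
    fun x hx => ?_, fun x hx => ?_⟩
  · rw [hf x hx, hF x hx]
    simp only [g, h₁]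
    ring
  · rw [hf x hx, hF x hx]
    simp only [G, h₂]
    ring
  · rw [hu' x hx]
    exact abs_integral_oscillatory_le hμ hγ (by positivity) ha0 hx hSb hh₁
  · have h := abs_integral_exponential_le hμ hγ (by positivity) ha0 hx hh₂
    rw [hv' x hx, add_sub_cancel_left, abs_mul, abs_neg, abs_of_pos (by positivity)]
    refine (mul_le_mul_of_nonneg_left h (by positivity)).trans_eq ?_
    field_simp
    norm_num

end

theorem statement17 (ω γ C0 : ℝ) (hω : 0 < ω) (hγ : 0 < γ) (hC0 : 0 < C0) :
    ∃ C : ℝ, 0 < C ∧ ∀ ξ : ℝ, ∀ V1 V2 : ℝ → ℝ,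
      ContDiff ℝ (⊤ : ℕ∞) V1 → ContDiff ℝ (⊤ : ℕ∞) V2 →
      (∀ x : ℝ, |V1 x| + |V2 x| ≤ C0 * Real.exp (-γ * |x|)) →
      ∃ x1 : ℝ, ∃ f41 f42 : ℝ → ℂ,
        SolvesGEP ξ ω V1 V2 f41 f42 (Set.Ioi x1) ∧
        (∀ x : ℝ, x1 ≤ x →
          max ‖f41 x‖ ‖f42 x‖ ≤ 2 * Real.exp (Real.sqrt (ξ ^ 2 + 4 * ω) * x)) ∧
        (∀ x : ℝ, x1 ≤ x →
          ‖(Real.exp (-(Real.sqrt (ξ ^ 2 + 4 * ω)) * x) : ℂ) * f41 x‖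
            ≤ C * Real.sqrt (ξ ^ 2 + 4 * ω) ^ (-(2 : ℝ)) * Real.sqrt (1 + x ^ 2) ^ 2 *
                Real.exp (-x * min γ (Real.sqrt (ξ ^ 2 + 4 * ω))) ∧
          ‖(Real.exp (-(Real.sqrt (ξ ^ 2 + 4 * ω)) * x) : ℂ) * f42 x - 1‖
            ≤ C * Real.sqrt (ξ ^ 2 + 4 * ω) ^ (-(1 : ℝ)) * Real.sqrt (1 + x ^ 2) ^ 2 *
                Real.exp (-x * min γ (Real.sqrt (ξ ^ 2 + 4 * ω)))) := by
  refine ⟨4 * C0 * (16 + 4 * γ ^ 2) + 2 * C0 * (1 + 1 / γ), by positivity,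
    fun ξ V1 V2 hV1 hV2 hV => ?_⟩
  have hpos : 0 < ξ ^ 2 + 4 * ω := by positivity
  have hμ := Real.sqrt_pos.2 hpos
  have hμ2 := Real.sq_sqrt hpos.le
  set μ := Real.sqrt (ξ ^ 2 + 4 * ω)
  obtain ⟨a, u, v, f, f', F, F', g, G, hf, hf', hF, hF', hg, hG, hfu, hFv, hu2, hv2, hu, hv⟩ :=
    exists_growing_jost_solution hμ hμ2 hγ hC0 hV1.continuous hV2.continuous hV
  have hcancel : ∀ x r : ℝ, exp (-μ * x) * (exp (μ * x) * r) = r := fun x r => by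
    rw [← mul_assoc, ← exp_add, neg_mul, neg_add_cancel, exp_zero, one_mul]
  have hsq : ∀ x : ℝ, Real.sqrt (1 + x ^ 2) ^ 2 = 1 + x ^ 2 := fun x =>
    Real.sq_sqrt (by positivity)
  have hrpow2 : μ ^ (-(2 : ℝ)) = 1 / μ ^ 2 := by
    rw [rpow_neg hμ.le, rpow_two, one_div]
  have hrpow1 : μ ^ (-(1 : ℝ)) = 1 / μ := by
    rw [rpow_neg hμ.le, rpow_one, one_div]
  refine ⟨a, fun x => (f x : ℂ), fun x => (F x : ℂ),
    solvesGEP_ofReal_s17 hf hf' hF hF' (fun x hx => hg x (le_of_lt hx))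
      (fun x hx => hG x (le_of_lt hx)), fun x hx => ?_, fun x hx => ⟨?_, ?_⟩⟩
  · rw [Complex.norm_real, Complex.norm_real, hfu x hx, hFv x hx, norm_mul, norm_mul,
      norm_eq_abs, norm_eq_abs, norm_eq_abs, abs_exp, mul_comm 2]
    exact max_le (by gcongr; exact hu2 x) (by gcongr; exact hv2 x)
  · rw [← Complex.ofReal_mul, Complex.norm_real, hfu x hx, hcancel, hsq, hrpow2, norm_eq_abs]
    refine (hu x hx).trans ?_
    rw [div_eq_mul_one_div]
    gcongr
    exact le_add_of_nonneg_right (by positivity)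
  · rw [← Complex.ofReal_mul, ← Complex.ofReal_one, ← Complex.ofReal_sub, Complex.norm_real,
      hFv x hx, hcancel, hsq, hrpow1, norm_eq_abs]
    refine (hv x hx).trans ?_
    rw [div_eq_mul_one_div]
    gcongr
    exact le_add_of_nonneg_left (by positivity)
end
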